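/- arXiv:2507.19528 — 3 statements merged into one kernel-verified Lean document; each statement's English description precedes it below -/
import Mathlib

section
/- For every ε > 0 there exists a constant C(ε) > 0 such that for all real numbers β, all real α with |α| ≥ 1, all real δ with 0 < δ < 1/2, and all real K ≥ 1, the number of integers k with K < k ≤ 2K and ‖β + α·√k‖ < δ is at most C(ε)·(K·δ + |α|^{1/2}·K^{1/4+ε} + K^{1/2+ε}). -/
open Real

theorem divisor_bound (ε : ℝ) (hε : 0 < ε) : ∃ C : ℝ, 1 ≤ C ∧ ∀ n : ℕ, n ≠ 0 →
    (n.divisors.card : ℝ) ≤ C * (n : ℝ) ^ ε := by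
  have hl2 : 0 < Real.log 2 := Real.log_pos (by norm_num)
  set C1 : ℝ := 1 + 1 / (ε * Real.log 2) with hC1
  have hC1' : 1 ≤ C1 := by rw [hC1]; have : 0 < 1 / (ε * Real.log 2) := by positivity
                           linarith
  obtain ⟨P, hP⟩ := exists_nat_ge ((2 : ℝ) ^ (1 / ε))
  refine ⟨C1 ^ P, one_le_pow₀ hC1', fun n hn => ?_⟩
  have hn' : (n : ℝ) ^ ε = ∏ p ∈ n.primeFactors, ((p : ℝ) ^ (n.factorization p)) ^ ε := by
    rw [Real.finsetProd_rpow _ _ (fun i _ => by positivity)]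
    congr 1
    have := Nat.prod_factorization_pow_eq_self hn
    conv_lhs => rw [← this]
    rw [Finsupp.prod, Nat.support_factorization]
    push_cast; rfl
  rw [Nat.card_divisors hn, hn']
  push_cast
  have key : ∀ p ∈ n.primeFactors, ((n.factorization p : ℝ) + 1) ≤
      (if p < P then C1 else 1) * ((p : ℝ) ^ (n.factorization p)) ^ ε := by
    intro p hp
    have hp2 : (2 : ℝ) ≤ p := by exact_mod_cast (Nat.prime_of_mem_primeFactors hp).two_le
    set v := n.factorization p
    have e1 : ((p : ℝ) ^ v) ^ ε = ((p : ℝ) ^ ε) ^ v := by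
      rw [← Real.rpow_natCast, ← Real.rpow_natCast, ← Real.rpow_mul (by positivity),
        ← Real.rpow_mul (by positivity), mul_comm]
    split_ifs with h
    · have h1 : 1 + ε * v * Real.log 2 ≤ ((p : ℝ) ^ v) ^ ε := by
        calc 1 + ε * v * Real.log 2 ≤ Real.exp (ε * v * Real.log 2) := by
              linarith [Real.add_one_le_exp (ε * v * Real.log 2)]
          _ = ((2 : ℝ) ^ v) ^ ε := by
              rw [← Real.rpow_natCast, ← Real.rpow_mul (by positivity),
                Real.rpow_def_of_pos (by norm_num)]
              congr 1; ring
          _ ≤ _ := by gcongr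
      calc (v : ℝ) + 1 ≤ C1 * (1 + ε * v * Real.log 2) := by
            have : C1 * (1 + ε * v * Real.log 2) =
              1 + ε * v * Real.log 2 + 1 / (ε * Real.log 2) + v := by
              rw [hC1]; field_simp; ring
            rw [this]
            have : 0 ≤ ε * v * Real.log 2 + 1 / (ε * Real.log 2) := by positivity
            linarith
        _ ≤ _ := by gcongr
    · rw [one_mul, e1]
      have h2 : (2 : ℝ) ≤ (p : ℝ) ^ ε := by
        have : (2 : ℝ) ^ (1 / ε) ≤ p := hP.trans (by exact_mod_cast not_lt.mp h)
        calc (2 : ℝ) = ((2 : ℝ) ^ (1 / ε)) ^ ε := by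
              rw [← Real.rpow_mul (by norm_num)]; field_simp; simp
          _ ≤ _ := by gcongr
      calc (v : ℝ) + 1 ≤ 2 ^ v := by exact_mod_cast Nat.lt_two_pow_self
        _ ≤ _ := by gcongr
  calc _ ≤ ∏ p ∈ n.primeFactors, ((if p < P then C1 else 1) * ((p : ℝ) ^ (n.factorization p)) ^ ε) :=
        Finset.prod_le_prod (fun i _ => by positivity) key
    _ = (∏ p ∈ n.primeFactors, (if p < P then C1 else 1)) * ∏ p ∈ n.primeFactors, ((p : ℝ) ^ (n.factorization p)) ^ ε :=
        Finset.prod_mul_distrib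
    _ ≤ _ := by
        gcongr
        rw [Finset.prod_ite, Finset.prod_const, Finset.prod_const_one, mul_one]
        apply pow_le_pow_right₀ hC1'
        calc _ ≤ (Finset.range P).card := Finset.card_le_card (by
              intro x hx; simp at hx ⊢; exact hx.2)
          _ = P := by simp

noncomputable def ee (x : ℝ) : ℂ := Complex.exp (Complex.I * ((2 * π * x : ℝ) : ℂ))

theorem ee_add (x y : ℝ) : ee (x + y) = ee x * ee y := by
  unfold ee; rw [← Complex.exp_add]; congr 1; push_cast; ring

theorem ee_norm (x : ℝ) : ‖ee x‖ = 1 := by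
  unfold ee; rw [mul_comm]; exact Complex.norm_exp_ofReal_mul_I _

theorem ee_conj (x : ℝ) : (starRingEnd ℂ) (ee x) = ee (-x) := by
  unfold ee; rw [← Complex.exp_conj]; congr 1; rw [map_mul, Complex.conj_I, Complex.conj_ofReal]; push_cast; ring

theorem ee_nat_mul (n : ℕ) (x : ℝ) : ee (n * x) = ee x ^ n := by
  unfold ee; rw [← Complex.exp_nat_mul]; congr 1; push_cast; ring

theorem ee_int (n : ℤ) : ee n = 1 := by
  unfold ee; rw [Complex.exp_eq_one_iff]; exact ⟨n, by push_cast; ring⟩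

theorem ee_re (x : ℝ) : (ee x).re = Real.cos (2 * π * x) := by
  unfold ee; rw [mul_comm, Complex.exp_ofReal_mul_I_re]

theorem ee_sub_int (x : ℝ) (n : ℤ) : ee (x - n) = ee x := by
  have := ee_add (x - n) n
  rw [ee_int, mul_one] at this
  rw [← this]; congr 1; ring

theorem geom_bound (M : ℕ) (x : ℝ) :
    ‖∑ i ∈ Finset.range M, ee x ^ i‖ * |x - round x| ≤ 1 := by
  have h1 := geom_sum_mul (ee x) M
  have h2 : ‖∑ i ∈ Finset.range M, ee x ^ i‖ * ‖ee x - 1‖ ≤ 2 := by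
    rw [← norm_mul, h1]
    calc _ ≤ ‖ee x ^ M‖ + ‖(1:ℂ)‖ := norm_sub_le _ _
      _ = 2 := by rw [norm_pow, ee_norm]; norm_num
  have h3 : 2 * |x - round x| ≤ ‖ee x - 1‖ := by
    rw [← ee_sub_int x (round x)]
    unfold ee
    rw [Complex.norm_exp_I_mul_ofReal_sub_one]
    have hx := abs_sub_round x
    set y := x - round x
    have : |π * y| ≤ π / 2 := by
      rw [abs_mul, abs_of_pos pi_pos]; nlinarith [pi_pos]
    have h4 := Real.mul_abs_le_abs_sin this
    rw [abs_mul, abs_of_pos pi_pos] at h4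
    have h5 : 2 / π * (π * |y|) = 2 * |y| := by field_simp
    rw [h5] at h4
    rw [Real.norm_eq_abs, abs_mul, abs_two, show 2 * π * y / 2 = π * y by ring]
    linarith [abs_nonneg y]
  have := norm_nonneg (∑ i ∈ Finset.range M, ee x ^ i)
  nlinarith [mul_le_mul_of_nonneg_left h3 this]

theorem normSq_sum (u : ℕ → ℂ) (N : ℕ) :
    ‖∑ n ∈ Finset.range N, u n‖ ^ 2 = ∑ n ∈ Finset.range N, ‖u n‖ ^ 2 +
      2 * ∑ m ∈ Finset.range N, (∑ n ∈ Finset.range (N - 1 - m),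
        u (n + m + 1) * (starRingEnd ℂ) (u n)).re := by
  induction N with
  | zero => simp
  | succ N ih =>
    have e1 : ∀ a b : ℂ, ‖a + b‖ ^ 2 = ‖a‖ ^ 2 + ‖b‖ ^ 2 + 2 * (b * (starRingEnd ℂ) a).re := by
      intro a b
      rw [← Complex.normSq_eq_norm_sq, ← Complex.normSq_eq_norm_sq, ← Complex.normSq_eq_norm_sq,
        Complex.normSq_add]
      congr 2
      simp; ring
    rw [Finset.sum_range_succ, e1, ih, Finset.sum_range_succ (fun n => ‖u n‖ ^ 2), Finset.sum_range_succ _ N]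
    have e2 : ∑ m ∈ Finset.range N, (∑ n ∈ Finset.range (N + 1 - 1 - m),
        u (n + m + 1) * (starRingEnd ℂ) (u n)).re = ∑ m ∈ Finset.range N, (∑ n ∈ Finset.range (N - 1 - m),
        u (n + m + 1) * (starRingEnd ℂ) (u n)).re + ∑ m ∈ Finset.range N, (u N * (starRingEnd ℂ) (u (N - 1 - m))).re := by
      rw [← Finset.sum_add_distrib]
      apply Finset.sum_congr rfl
      intro m hm
      rw [Finset.mem_range] at hm
      rw [show N + 1 - 1 - m = (N - 1 - m) + 1 by omega, Finset.sum_range_succ, Complex.add_re,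
        show N - 1 - m + m + 1 = N by omega]
    rw [e2, Finset.sum_range_reflect (fun j => (u N * (starRingEnd ℂ) (u j)).re) N]
    have e3 : (u N * (starRingEnd ℂ) (∑ n ∈ Finset.range N, u n)).re =
        ∑ j ∈ Finset.range N, (u N * (starRingEnd ℂ) (u j)).re := by
      rw [map_sum, Finset.mul_sum, Complex.re_sum]
    rw [e3]
    simp only [Nat.add_sub_cancel, Nat.sub_self, Finset.range_zero, Finset.sum_empty, Complex.zero_re]
    ring

theorem weyl (A B c : ℝ) (N : ℕ) (hN : 0 < N) :
    ‖∑ n ∈ Finset.range N, ee (A * n ^ 2 + B * n + c)‖ ^ 2 ≤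
      N + 2 * ∑ m ∈ Finset.range N, 2 / (1 / (N : ℝ) + |2 * A * (m + 1) - round (2 * A * (m + 1))|) := by
  rw [normSq_sum]
  simp only [ee_norm, one_pow, Finset.sum_const, Finset.card_range, nsmul_eq_mul, mul_one]
  gcongr with m hm
  refine (Complex.re_le_norm _).trans ?_
  have e : ∀ n : ℕ, ee (A * ((n + m + 1 : ℕ) : ℝ) ^ 2 + B * ((n + m + 1 : ℕ) : ℝ) + c) *
      (starRingEnd ℂ) (ee (A * (n:ℝ) ^ 2 + B * n + c)) =
      ee (A * (m + 1) ^ 2 + B * (m + 1)) * ee (2 * A * (m + 1)) ^ n := by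
    intro n
    rw [ee_conj, ← ee_add, ← ee_nat_mul, ← ee_add]
    congr 1; push_cast; ring
  simp only [e]
  rw [← Finset.mul_sum, norm_mul, ee_norm, one_mul]
  have h1 := geom_bound (N - 1 - m) (2 * A * (m + 1))
  have h2 : ‖∑ i ∈ Finset.range (N - 1 - m), ee (2 * A * (m + 1)) ^ i‖ ≤ N := by
    refine (norm_sum_le _ _).trans ?_
    simp only [norm_pow, ee_norm, one_pow, Finset.sum_const, Finset.card_range, nsmul_eq_mul, mul_one]
    exact_mod_cast (by omega)
  have hN' : (0:ℝ) < N := by exact_mod_cast hN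
  rw [le_div_iff₀ (by positivity), mul_add]
  have h3 : ‖∑ i ∈ Finset.range (N - 1 - m), ee (2 * A * (m + 1)) ^ i‖ * (1 / N) ≤ 1 := by
    rw [mul_one_div, div_le_one hN']; exact h2
  linarith

theorem fejer (x : ℕ → ℝ) (N H : ℕ) (η : ℝ) (hH : 8 * η * H ≤ 1) :
    (((Finset.range N).filter (fun n => |x n - round (x n)| < η)).card : ℝ) * (H : ℝ) ^ 2 / 4 ≤
      H * N + 2 * H * ∑ h ∈ Finset.range H, ‖∑ n ∈ Finset.range N, ee ((h + 1 : ℝ) * x n)‖ := by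
  have h1 : ∀ n ∈ (Finset.range N).filter (fun n => |x n - round (x n)| < η),
      (H : ℝ) ^ 2 / 4 ≤ ‖∑ h ∈ Finset.range H, ee (h * x n)‖ ^ 2 := by
    intro n hn
    have hn := (Finset.mem_filter.mp hn).2
    have : (H : ℝ) / 2 ≤ ‖∑ h ∈ Finset.range H, ee (h * x n)‖ := by
      refine le_trans ?_ (Complex.re_le_norm _)
      rw [Complex.re_sum]
      calc (H : ℝ) / 2 = ∑ h ∈ Finset.range H, (1/2 : ℝ) := by simp; ring
        _ ≤ _ := by
          apply Finset.sum_le_sum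
          intro h hh
          have hh' : (h : ℝ) ≤ H := by exact_mod_cast (Finset.mem_range.mp hh).le
          have : ee (h * x n) = ee (h * (x n - round (x n))) := by
            rw [← ee_sub_int (h * x n) (h * round (x n))]; congr 1; push_cast; ring
          rw [this, ee_re, ← Real.cos_abs, ← Real.cos_pi_div_three]
          apply Real.cos_le_cos_of_nonneg_of_le_pi (abs_nonneg _) (by linarith [pi_pos])
          have h0 : |(h:ℝ) * (x n - round (x n))| ≤ 1 / 8 := by
            rw [abs_mul, Nat.abs_cast]
            have : (h:ℝ) * |x n - round (x n)| ≤ H * η := by gcongr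
            linarith
          rw [abs_mul, abs_of_pos (by positivity : (0:ℝ) < 2 * π)]
          nlinarith [pi_pos]
    have h0 : (0:ℝ) ≤ H := by positivity
    nlinarith
  have h2 : ∀ n, ‖∑ h ∈ Finset.range H, ee (h * x n)‖ ^ 2 =
      H + 2 * ∑ m ∈ Finset.range H, ((H - 1 - m : ℕ) : ℝ) * (ee ((m + 1 : ℝ) * x n)).re := by
    intro n
    rw [normSq_sum]
    simp only [ee_norm, one_pow, Finset.sum_const, Finset.card_range, nsmul_eq_mul, mul_one]
    congr 2
    apply Finset.sum_congr rfl
    intro m _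
    have : ∀ h : ℕ, ee (((h + m + 1 : ℕ) : ℝ) * x n) * (starRingEnd ℂ) (ee (h * x n)) =
        ee ((m + 1 : ℝ) * x n) := by
      intro h; rw [ee_conj, ← ee_add]; congr 1; push_cast; ring
    simp only [this]
    simp
  calc _ = ∑ n ∈ (Finset.range N).filter (fun n => |x n - round (x n)| < η), (H : ℝ) ^ 2 / 4 := by
        simp; ring
    _ ≤ ∑ n ∈ (Finset.range N).filter (fun n => |x n - round (x n)| < η),
          ‖∑ h ∈ Finset.range H, ee (h * x n)‖ ^ 2 := Finset.sum_le_sum h1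
    _ ≤ ∑ n ∈ Finset.range N, ‖∑ h ∈ Finset.range H, ee (h * x n)‖ ^ 2 :=
        Finset.sum_le_sum_of_subset_of_nonneg (Finset.filter_subset _ _) (fun _ _ _ => by positivity)
    _ = H * N + 2 * ∑ m ∈ Finset.range H, ((H - 1 - m : ℕ) : ℝ) *
          (∑ n ∈ Finset.range N, ee ((m + 1 : ℝ) * x n)).re := by
        simp only [h2]
        rw [Finset.sum_add_distrib, ← Finset.mul_sum, Finset.sum_comm]
        simp only [← Finset.mul_sum, Complex.re_sum]
        simp; ring
    _ ≤ _ := by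
        rw [mul_assoc 2, Finset.mul_sum (Finset.range H) _ (H:ℝ)]
        refine add_le_add le_rfl (mul_le_mul_of_nonneg_left (Finset.sum_le_sum fun m hm => ?_) (by norm_num))
        have h5 : ((H - 1 - m : ℕ) : ℝ) ≤ H := by
          have : H - 1 - m ≤ H := by omega
          exact_mod_cast this
        exact (mul_le_mul_of_nonneg_left (Complex.re_le_norm _) (by positivity)).trans
          (mul_le_mul_of_nonneg_right h5 (norm_nonneg _))

theorem divisor_sum (g : ℕ → ℝ) (hg : ∀ l, 0 ≤ g l) (H N : ℕ) (D : ℝ)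
    (hD : ∀ l ∈ Finset.Icc 1 (2 * H * N), (l.divisors.card : ℝ) ≤ D) :
    ∑ h ∈ Finset.range H, ∑ m ∈ Finset.range N, g (2 * (h + 1) * (m + 1)) ≤
      D * ∑ l ∈ Finset.Icc 1 (2 * H * N), g l := by
  rw [← Finset.sum_product' (Finset.range H) (Finset.range N) (fun h m => g (2 * (h + 1) * (m + 1)))]
  have hm : ∀ p ∈ Finset.range H ×ˢ Finset.range N,
      2 * (p.1 + 1) * (p.2 + 1) ∈ Finset.Icc 1 (2 * H * N) := by
    intro p hp
    simp only [Finset.mem_product, Finset.mem_range] at hp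
    rw [Finset.mem_Icc]
    constructor
    · have : 0 < 2 * (p.1 + 1) * (p.2 + 1) := by positivity
      omega
    · exact Nat.mul_le_mul (by omega) (by omega)
  rw [← Finset.sum_fiberwise_of_maps_to hm, Finset.mul_sum]
  apply Finset.sum_le_sum
  intro l hl
  calc _ = ∑ p ∈ (Finset.range H ×ˢ Finset.range N).filter
        (fun p => 2 * (p.1 + 1) * (p.2 + 1) = l), g l := by
        apply Finset.sum_congr rfl
        intro p hp
        rw [(Finset.mem_filter.mp hp).2]
    _ = (((Finset.range H ×ˢ Finset.range N).filter
        (fun p => 2 * (p.1 + 1) * (p.2 + 1) = l)).card : ℝ) * g l := by simp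
    _ ≤ _ := by
        apply mul_le_mul_of_nonneg_right _ (hg l)
        refine le_trans ?_ (hD l hl)
        norm_cast
        apply Finset.card_le_card_of_injOn (fun p => p.1 + 1)
        · intro p hp
          have hp := (Finset.mem_filter.mp (Finset.mem_coe.mp hp)).2
          have : l ≠ 0 := by have := (Finset.mem_Icc.mp hl).1; omega
          simp only [Finset.mem_coe, Nat.mem_divisors]
          exact ⟨⟨2 * (p.2 + 1), by rw [← hp]; ring⟩, this⟩
        · intro p hp q hq hpq
          have hp := (Finset.mem_filter.mp (Finset.mem_coe.mp hp)).2
          have hq := (Finset.mem_filter.mp (Finset.mem_coe.mp hq)).2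
          have e : p.1 = q.1 := by simpa using hpq
          rw [← hq, e] at hp
          have := Nat.eq_of_mul_eq_mul_left (by positivity) hp
          exact Prod.ext e (by omega)


theorem sumG (θ : ℝ) (h0 : 0 < θ) (h1 : θ ≤ 1) (N L : ℕ) (hN : 0 < N) :
    ∑ l ∈ Finset.Icc 1 L, 2 / (1 / (N : ℝ) + |l * θ - round (l * θ)|) ≤
      (L * θ + 2) * (4 * (N + 1 / θ * (1 + Real.log (1 / θ)))) := by
  have hN' : (0:ℝ) < N := by exact_mod_cast hN
  set M := ⌊1 / θ⌋₊ with hM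
  have hM1 : 1 ≤ M := by
    rw [hM]; apply Nat.le_floor; rw [le_div_iff₀ h0]; simpa using h1
  set w : ℕ → ℝ := fun i => 2 / (1 / (N : ℝ) + θ * i) with hw
  let i' : ℕ → ℤ := fun l => ⌊(l : ℝ) - round (l * θ) / θ⌋
  let φ : ℕ → ℕ × Bool × ℕ := fun l => ((round (l * θ)).toNat, decide (0 ≤ i' l),
    if 0 ≤ i' l then (i' l).toNat else (-(i' l) - 1).toNat)
  let T : Finset (ℕ × Bool × ℕ) := Finset.range (⌊L * θ⌋₊ + 2) ×ˢ (Finset.univ ×ˢ Finset.range (M + 1))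
  have hround0 : ∀ l : ℕ, 0 ≤ round (l * θ) := by
    intro l
    rw [round_eq]; apply Int.floor_nonneg.mpr; positivity
  have habs : ∀ l : ℕ, |(l:ℝ) - round (l * θ) / θ| * θ = |l * θ - round (l * θ)| := by
    intro l
    conv_lhs => rw [← abs_of_pos h0]
    rw [abs_of_pos h0]
    nth_rw 3 [← abs_of_pos h0]
    rw [← abs_mul]; congr 1; field_simp
  have habs2 : ∀ l : ℕ, |(l:ℝ) - round (l * θ) / θ| ≤ 1 / (2 * θ) := by
    intro l
    have := abs_sub_round ((l:ℝ) * θ)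
    rw [← habs] at this
    rw [le_div_iff₀ (by positivity)]; linarith
  have hθ2 : 1 / (2 * θ) ≤ 1 / θ := by
    apply one_div_le_one_div_of_le h0; linarith
  have hidx : ∀ l, ((φ l).2.2 : ℝ) ≤ |(l:ℝ) - round (l * θ) / θ| := by
    intro l
    simp only [φ]
    have hf1 : ((i' l : ℤ) : ℝ) ≤ (l : ℝ) - round (l * θ) / θ := Int.floor_le _
    have hf2 : (l : ℝ) - round (l * θ) / θ < (i' l : ℤ) + 1 := Int.lt_floor_add_one _
    split_ifs with h
    · have e : (((i' l).toNat : ℕ) : ℝ) = ((i' l : ℤ) : ℝ) := by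
        exact_mod_cast congrArg (Int.cast (R := ℝ)) (Int.toNat_of_nonneg h)
      rw [e]; exact hf1.trans (le_abs_self _)
    · have e : (((-(i' l) - 1).toNat : ℕ) : ℝ) = ((-(i' l) - 1 : ℤ) : ℝ) := by
        exact_mod_cast congrArg (Int.cast (R := ℝ)) (Int.toNat_of_nonneg (by omega : 0 ≤ -(i' l) - 1))
      rw [e]; push_cast
      refine le_trans ?_ (neg_le_abs _)
      linarith
  have hmaps : ∀ l ∈ Finset.Icc 1 L, φ l ∈ T := by
    intro l hl
    have hlL : (l:ℝ) ≤ L := by exact_mod_cast (Finset.mem_Icc.mp hl).2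
    simp only [T, Finset.mem_product, Finset.mem_univ, true_and, Finset.mem_range]
    constructor
    · simp only [φ]
      have h3 : round ((l:ℝ) * θ) < (⌊L * θ⌋₊ : ℤ) + 2 := by
        have : ((round ((l:ℝ) * θ) : ℤ) : ℝ) < ((⌊L * θ⌋₊ : ℤ) + 2 : ℤ) := by
          have a1 := (abs_le.mp (abs_sub_round ((l:ℝ) * θ))).1
          have a2 := Nat.lt_floor_add_one ((L:ℝ) * θ)
          have a3 : (l:ℝ) * θ ≤ L * θ := by gcongr
          push_cast; linarith
        exact_mod_cast this
      have := hround0 l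
      omega
    · apply Nat.lt_succ_of_le
      rw [hM]; apply Nat.le_floor
      exact (hidx l).trans ((habs2 l).trans hθ2)
  have hinj : Set.InjOn φ (Finset.Icc 1 L : Finset ℕ) := by
    intro a _ b _ hab
    simp only [φ, Prod.mk.injEq] at hab
    obtain ⟨hj, hb, hi⟩ := hab
    have hj' : round ((a:ℝ) * θ) = round ((b:ℝ) * θ) := by
      have := hround0 a; have := hround0 b; omega
    have hii : i' a = i' b := by
      have hb' : (0 ≤ i' a) ↔ (0 ≤ i' b) := by simpa using hb
      by_cases h : 0 ≤ i' a
      · have h' := hb'.mp h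
        simp only [h, h', if_true] at hi; omega
      · have h' : ¬ (0 ≤ i' b) := fun t => h (hb'.mpr t)
        rw [if_neg h, if_neg h'] at hi; omega
    simp only [i'] at hii
    rw [hj', sub_eq_add_neg, sub_eq_add_neg, Int.floor_natCast_add, Int.floor_natCast_add] at hii
    omega
  calc _ ≤ ∑ l ∈ Finset.Icc 1 L, w (φ l).2.2 := by
        apply Finset.sum_le_sum
        intro l _
        simp only [hw]
        have := hidx l
        rw [← habs l]
        rw [mul_comm θ]
        gcongr
    _ = ∑ t ∈ (Finset.Icc 1 L).image φ, w t.2.2 := by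
        rw [Finset.sum_image hinj]
    _ ≤ ∑ t ∈ T, w t.2.2 := by
        apply Finset.sum_le_sum_of_subset_of_nonneg
        · intro t ht
          obtain ⟨l, hl, rfl⟩ := Finset.mem_image.mp ht
          exact hmaps l hl
        · intro t _ _; simp only [hw]; positivity
    _ = (⌊L * θ⌋₊ + 2 : ℝ) * (2 * ∑ i ∈ Finset.range (M + 1), w i) := by
        simp only [T]
        rw [Finset.sum_product]
        simp only [Finset.sum_product]
        simp
    _ ≤ _ := by
        have a1 : (⌊L * θ⌋₊ : ℝ) ≤ L * θ := Nat.floor_le (by positivity)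
        have a2 : ∑ i ∈ Finset.range (M + 1), w i ≤ 2 * (N + 1 / θ * (1 + Real.log (1 / θ))) := by
          rw [Finset.sum_range_succ']
          have b1 : w 0 = 2 * N := by simp [hw]
          have b2 : ∑ i ∈ Finset.range M, w (i + 1) ≤ 2 / θ * (harmonic M : ℝ) := by
            unfold harmonic
            push_cast
            rw [Finset.mul_sum]
            apply Finset.sum_le_sum
            intro i _
            simp only [hw]
            rw [← div_eq_mul_inv, div_div]
            push_cast
            gcongr
            have : (0:ℝ) ≤ 1 / N := by positivity
            linarith
          have b3 := harmonic_le_one_add_log M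
          have b4 : Real.log M ≤ Real.log (1 / θ) := by
            apply Real.log_le_log (by exact_mod_cast hM1)
            exact Nat.floor_le (by positivity)
          have b5 : 2 / θ * (harmonic M : ℝ) ≤ 2 / θ * (1 + Real.log (1 / θ)) := by
            gcongr; linarith
          rw [b1]
          have : 2 / θ * (1 + Real.log (1 / θ)) = 2 * (1 / θ * (1 + Real.log (1 / θ))) := by ring
          linarith
        have a3 : 0 ≤ ∑ i ∈ Finset.range (M + 1), w i := by
          apply Finset.sum_nonneg; intro i _; simp only [hw]; positivity
        apply mul_le_mul (by linarith) (by linarith) (by linarith) (by positivity)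

theorem quad_count (θ b η D : ℝ) (h0 : 0 < θ) (h1 : θ ≤ 1) (N H : ℕ) (hN : 0 < N) (hHp : 0 < H)
    (hH : 8 * η * H ≤ 1)
    (hD : ∀ l ∈ Finset.Icc 1 (2 * H * N), (l.divisors.card : ℝ) ≤ D) (hD0 : 0 ≤ D) :
    (((Finset.range N).filter (fun n : ℕ => |θ * (n + b) ^ 2 - round (θ * (n + b) ^ 2)| < η)).card : ℝ) ≤
      4 * (N / H) + 8 * Real.sqrt (N + 16 * D * (N * θ + 1 / H) * (N + 1 / θ * (1 + Real.log (1 / θ)))) := by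
  have hH' : (0:ℝ) < H := by exact_mod_cast hHp
  have hf := fejer (fun n : ℕ => θ * (n + b) ^ 2) N H η hH
  set cnt := (((Finset.range N).filter (fun n : ℕ => |θ * (n + b) ^ 2 - round (θ * (n + b) ^ 2)| < η)).card : ℝ)
  set S : ℕ → ℝ := fun h => ‖∑ n ∈ Finset.range N, ee ((h + 1 : ℝ) * (θ * (n + b) ^ 2))‖ with hS
  have hw : ∀ h : ℕ, S h ^ 2 ≤ N + 2 * ∑ m ∈ Finset.range N,
      2 / (1 / (N : ℝ) + |((2 * (h + 1) * (m + 1) : ℕ) : ℝ) * θ - round (((2 * (h + 1) * (m + 1) : ℕ) : ℝ) * θ)|) := by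
    intro h
    have := weyl ((h + 1) * θ) (2 * (h + 1) * θ * b) ((h + 1) * θ * b ^ 2) N hN
    simp only [hS]
    convert this using 3
    · congr 1
      funext n
      congr 1; ring
    · apply Finset.sum_congr rfl
      intro m _
      have : ((2 * (h + 1) * (m + 1) : ℕ) : ℝ) * θ = 2 * ((h + 1) * θ) * (m + 1) := by push_cast; ring
      rw [this]
  set X := 16 * D * (N * θ + 1 / H) * (N + 1 / θ * (1 + Real.log (1 / θ))) with hX
  have hsq : ∑ h ∈ Finset.range H, S h ^ 2 ≤ H * (N + X) := by
    calc _ ≤ ∑ h ∈ Finset.range H, ((N:ℝ) + 2 * ∑ m ∈ Finset.range N,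
      2 / (1 / (N : ℝ) + |((2 * (h + 1) * (m + 1) : ℕ) : ℝ) * θ - round (((2 * (h + 1) * (m + 1) : ℕ) : ℝ) * θ)|)) :=
          Finset.sum_le_sum fun h _ => hw h
      _ = H * N + 2 * ∑ h ∈ Finset.range H, ∑ m ∈ Finset.range N,
      2 / (1 / (N : ℝ) + |((2 * (h + 1) * (m + 1) : ℕ) : ℝ) * θ - round (((2 * (h + 1) * (m + 1) : ℕ) : ℝ) * θ)|) := by
          rw [Finset.sum_add_distrib, Finset.mul_sum]; simp
      _ ≤ H * N + 2 * (D * ∑ l ∈ Finset.Icc 1 (2 * H * N), 2 / (1 / (N : ℝ) + |l * θ - round (l * θ)|)) := by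
          gcongr
          exact divisor_sum (fun l : ℕ => 2 / (1 / (N : ℝ) + |l * θ - round (l * θ)|))
            (fun l => by positivity) H N D hD
      _ ≤ H * N + 2 * (D * (((2 * H * N : ℕ) * θ + 2) * (4 * (N + 1 / θ * (1 + Real.log (1 / θ)))))) := by
          gcongr
          exact sumG θ h0 h1 N _ hN
      _ = _ := by
          rw [hX]; push_cast; field_simp; ring
  have hcs : (∑ h ∈ Finset.range H, S h) ^ 2 ≤ H * ∑ h ∈ Finset.range H, S h ^ 2 := by
    have := sq_sum_le_card_mul_sum_sq (s := Finset.range H) (f := S)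
    simpa using this
  have hsum : (∑ h ∈ Finset.range H, S h) ≤ H * Real.sqrt (N + X) := by
    rw [← Real.sqrt_sq hH'.le, ← Real.sqrt_mul (by positivity)]
    apply Real.le_sqrt_of_sq_le
    calc _ ≤ _ := hcs
      _ ≤ H * (H * (N + X)) := by gcongr
      _ = _ := by ring
  have hf2 : cnt * (H:ℝ) ^ 2 / 4 ≤ H * N + 2 * H * (H * Real.sqrt (N + X)) := by
    refine hf.trans ?_
    gcongr
  have : cnt * (H:ℝ)^2 ≤ (4 * (N / H) + 8 * Real.sqrt (N + X)) * (H:ℝ)^2 := by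
    have : (4 * (N / H) + 8 * Real.sqrt (N + X)) * (H:ℝ)^2 = 4 * (H * N + 2 * H * (H * Real.sqrt (N + X))) := by
      field_simp; ring
    rw [this]; linarith
  exact le_of_mul_le_mul_right this (by positivity)

theorem card_near (T : Finset ℕ) (x η : ℝ) (hη : 0 < η) (h : ∀ k ∈ T, |x - (k:ℝ)| < η) :
    (T.card : ℝ) ≤ 2 * η + 1 := by
  have h1 : T.card ≤ (Finset.Icc ⌈x - η⌉ ⌊x + η⌋).card := by
    apply Finset.card_le_card_of_injOn (fun k : ℕ => (k : ℤ))
    · intro k hk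
      have := abs_lt.mp (h k hk)
      simp only [Finset.coe_Icc, Set.mem_Icc]
      constructor
      · apply Int.ceil_le.mpr; push_cast; linarith
      · apply Int.le_floor.mpr; push_cast; linarith
    · intro a _ b _ hab
      simpa using hab
  have h2 : ((Finset.Icc ⌈x - η⌉ ⌊x + η⌋).card : ℝ) ≤ 2 * η + 1 := by
    rw [Int.card_Icc]
    have a1 := Int.floor_le (x + η)
    have a2 := Int.le_ceil (x - η)
    rcases le_total 0 (⌊x + η⌋ + 1 - ⌈x - η⌉) with h | h
    · have e : (((⌊x + η⌋ + 1 - ⌈x - η⌉).toNat : ℕ) : ℝ) = ((⌊x + η⌋ + 1 - ⌈x - η⌉ : ℤ) : ℝ) := by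
        exact_mod_cast congrArg (Int.cast (R := ℝ)) (Int.toNat_of_nonneg h)
      rw [e]; push_cast; linarith
    · rw [Int.toNat_of_nonpos h]; push_cast; linarith
  exact le_trans (by exact_mod_cast h1) h2

theorem reduce (S : Finset ℕ) (β a δ K : ℝ) (ha : 1 ≤ a) (hδ : 0 < δ) (hδ1 : δ ≤ 1) (hK : 1 ≤ K)
    (hS : ∀ k ∈ S, K < (k:ℝ) ∧ (k:ℝ) ≤ 2 * K ∧
      |(β + a * Real.sqrt k) - round (β + a * Real.sqrt k)| < δ) :
    ∃ b : ℝ, ∃ N : ℕ, 0 < N ∧ (N : ℝ) ≤ 4 * (a * Real.sqrt K) ∧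
      (S.card : ℝ) ≤ (2 * (4 * δ * Real.sqrt K / a) + 1) *
        (((Finset.range N).filter (fun n : ℕ => |1 / a ^ 2 * (n + b) ^ 2 - round (1 / a ^ 2 * (n + b) ^ 2)|
          < 4 * δ * Real.sqrt K / a)).card : ℝ) := by
  set η := 4 * δ * Real.sqrt K / a with hη
  have hsK : 1 ≤ Real.sqrt K := Real.one_le_sqrt.mpr hK
  have hη0 : 0 < η := by rw [hη]; positivity
  have haK : 1 ≤ a * Real.sqrt K := by nlinarith
  set n0 : ℤ := ⌊β + a * Real.sqrt K⌋ with hn0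
  set b : ℝ := n0 - β with hb
  set N : ℕ := ⌊a * Real.sqrt K⌋₊ + 3 with hN
  refine ⟨b, N, by omega, ?_, ?_⟩
  · have := Nat.floor_le (by positivity : 0 ≤ a * Real.sqrt K)
    rw [hN]; push_cast; linarith
  set A := (Finset.range N).filter (fun n : ℕ => |1 / a ^ 2 * (n + b) ^ 2 - round (1 / a ^ 2 * (n + b) ^ 2)| < η) with hA
  let φ : ℕ → ℕ := fun k => (round (β + a * Real.sqrt k) - n0).toNat
  have hs : ∀ k ∈ S, Real.sqrt K ≤ Real.sqrt k ∧ Real.sqrt k ≤ 3 / 2 * Real.sqrt K := by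
    intro k hk
    obtain ⟨h1, h2, h3⟩ := hS k hk
    refine ⟨Real.sqrt_le_sqrt h1.le, ?_⟩
    apply Real.sqrt_le_iff.mpr
    refine ⟨by positivity, ?_⟩
    rw [mul_pow, Real.sq_sqrt (by linarith)]; linarith
  have hcast : ∀ k ∈ S, ((φ k : ℕ) : ℝ) = round (β + a * Real.sqrt k) - n0 := by
    intro k hk
    have : 0 ≤ round (β + a * Real.sqrt k) - n0 := by
      have e1 : n0 ≤ ⌊β + a * Real.sqrt k⌋ := by
        apply Int.floor_le_floor
        have := (hs k hk).1
        gcongr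
      have e2 : ⌊β + a * Real.sqrt k⌋ ≤ round (β + a * Real.sqrt k) := by
        rw [round_eq]; apply Int.floor_le_floor; linarith
      omega
    have e := congrArg (Int.cast (R := ℝ)) (Int.toNat_of_nonneg this)
    simp only [φ]
    push_cast at e
    exact_mod_cast e
  have hnear : ∀ k ∈ S, |1 / a ^ 2 * ((φ k : ℝ) + b) ^ 2 - (k:ℝ)| < η := by
    intro k hk
    obtain ⟨h1, h2, h3⟩ := hS k hk
    rw [hcast k hk, hb]
    set z : ℝ := ((round (β + a * Real.sqrt k) : ℤ) : ℝ)
    set s := Real.sqrt k with hsdef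
    have hss : (k:ℝ) = s ^ 2 := by rw [hsdef, Real.sq_sqrt (by positivity)]
    have hs2 := hs k hk
    have e : 1 / a ^ 2 * (z - n0 + (n0 - β)) ^ 2 - (k:ℝ) = (z - β - a * s) * (z - β + a * s) / a ^ 2 := by
      rw [hss]; field_simp; ring
    rw [e, abs_div, abs_mul, abs_of_pos (by positivity : 0 < a ^ 2), div_lt_iff₀ (by positivity)]
    have e2 : η * a ^ 2 = δ * (4 * (a * Real.sqrt K)) := by rw [hη]; field_simp
    rw [e2]
    have e3 : |z - β - a * s| < δ := by
      rw [← abs_neg]; convert h3 using 2; ring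
    have e4 : |z - β + a * s| ≤ 4 * (a * Real.sqrt K) := by
      have q1 := abs_lt.mp e3
      have q2 : a * s ≤ a * (3 / 2 * Real.sqrt K) := by gcongr; exact hs2.2
      have q3 : 0 ≤ a * s := by positivity
      rw [abs_le]; constructor <;> linarith
    calc _ ≤ |z - β - a * s| * (4 * (a * Real.sqrt K)) := by gcongr
      _ < _ := by gcongr
  have hmaps : ∀ k ∈ S, φ k ∈ A := by
    intro k hk
    rw [hA, Finset.mem_filter, Finset.mem_range]
    constructor
    · have : ((φ k : ℕ) : ℝ) < (N : ℕ) := by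
        rw [hcast k hk, hN]
        have q1 := abs_le.mp (abs_sub_round (β + a * Real.sqrt k))
        have q2 := Int.lt_floor_add_one (β + a * Real.sqrt K)
        have q3 := Nat.lt_floor_add_one (a * Real.sqrt K)
        have q4 : a * Real.sqrt k ≤ a * (3 / 2 * Real.sqrt K) := by gcongr; exact (hs k hk).2
        push_cast
        rw [hn0]
        linarith
      exact_mod_cast this
    · refine lt_of_le_of_lt ?_ (hnear k hk)
      have := round_le (1 / a ^ 2 * ((φ k : ℝ) + b) ^ 2) (k : ℤ)
      rw [Int.cast_natCast] at this
      exact this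
  have hcard : (S.card : ℝ) = ∑ i ∈ A, ((S.filter (fun k => φ k = i)).card : ℝ) := by
    exact_mod_cast Finset.card_eq_sum_card_fiberwise (fun k hk => hmaps k hk)
  rw [hcard]
  calc _ ≤ ∑ i ∈ A, (2 * η + 1) := by
        apply Finset.sum_le_sum
        intro i _
        apply card_near _ (1 / a ^ 2 * ((i : ℝ) + b) ^ 2) η hη0
        intro k hk
        obtain ⟨hk1, hk2⟩ := Finset.mem_filter.mp hk
        rw [← hk2]; exact hnear k hk1
    _ = _ := by rw [Finset.sum_const, nsmul_eq_mul]; ring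

set_option maxHeartbeats 1000000 in
theorem core (ε : ℝ) (hε : 0 < ε) : ∃ C : ℝ, 0 < C ∧ ∀ (S : Finset ℕ) (β a δ K : ℝ),
    1 ≤ a → a ≤ K ^ 2 → 0 < δ → δ ≤ 1 → 1 ≤ K → 1 ≤ δ * Real.sqrt K →
    (∀ k ∈ S, K < (k:ℝ) ∧ (k:ℝ) ≤ 2 * K ∧
      |(β + a * Real.sqrt k) - round (β + a * Real.sqrt k)| < δ) →
    (S.card : ℝ) ≤ C * (K * δ + K ^ ε * (Real.sqrt K + Real.sqrt (a * Real.sqrt K))) := by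
  obtain ⟨C0, hC0, hdiv⟩ := divisor_bound (ε / 3) (by positivity)
  set C1 : ℝ := 1 + 4 / (ε / 3) with hC1
  have hC1' : 1 ≤ C1 := by
    have : 0 < 4 / (ε / 3) := by positivity
    linarith
  refine ⟨2048 + 16 * Real.sqrt (4356 * (C0 * C1)), by positivity, ?_⟩
  intro S β a δ K ha haK hδ hδ1 hK hδK hS
  obtain ⟨b, N, hN, hN4, hcard⟩ := reduce S β a δ K ha hδ hδ1 hK hS
  have hsK : 1 ≤ Real.sqrt K := Real.one_le_sqrt.mpr hK
  have hss : Real.sqrt K * Real.sqrt K = K := Real.mul_self_sqrt (by linarith)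
  have hsK2 : Real.sqrt K ≤ K := by nlinarith
  set s := Real.sqrt K with hs
  set q := a * s with hq
  have hq1 : 1 ≤ q := by nlinarith
  set η := 4 * δ * s / a with hη
  have hη0 : 0 < η := by positivity
  set A := (Finset.range N).filter (fun n : ℕ => |1 / a ^ 2 * (n + b) ^ 2 - round (1 / a ^ 2 * (n + b) ^ 2)| < η) with hA
  have hηq : η * q = 4 * (K * δ) := by
    rw [hη, hq, ← hss]; field_simp
  have hR : 0 ≤ K ^ ε * (s + Real.sqrt q) := by positivity
  have hKδ : 0 ≤ K * δ := by positivity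
  have hsq0 := Real.sqrt_nonneg (4356 * (C0 * C1))
  rcases le_or_gt (1 / 8) η with hc | hc
  · have hA1 : (A.card : ℝ) ≤ N := by
      have : A.card ≤ (Finset.range N).card := Finset.card_filter_le _ _
      rw [Finset.card_range] at this
      exact_mod_cast this
    calc (S.card : ℝ) ≤ (2 * η + 1) * A.card := hcard
      _ ≤ (10 * η) * (4 * q) := by
          apply mul_le_mul (by linarith) (by linarith) (by positivity) (by positivity)
      _ = 160 * (K * δ) := by linarith
      _ ≤ 2048 * (K * δ + K ^ ε * (s + Real.sqrt q)) := by linarith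
      _ ≤ _ := by gcongr; linarith
  · set H : ℕ := ⌊1 / (8 * η)⌋₊ with hH
    have h18 : 1 ≤ 1 / (8 * η) := by rw [le_div_iff₀ (by positivity)]; linarith
    have hHp : 0 < H := Nat.floor_pos.mpr h18
    have hHle : (H:ℝ) ≤ 1 / (8 * η) := Nat.floor_le (by positivity)
    have hH' : (0:ℝ) < H := by exact_mod_cast hHp
    have hH1 : (1:ℝ) ≤ H := by exact_mod_cast hHp
    have hHge : 1 / (8 * η) ≤ 2 * H := by
      have := Nat.lt_floor_add_one (1 / (8 * η))
      rw [← hH] at this; linarith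
    have hHinv : 1 / (H:ℝ) ≤ 16 * η := by
      rw [div_le_iff₀ (by positivity)] at hHge ⊢; linarith
    have hH8 : 8 * η * H ≤ 1 := by
      rw [le_div_iff₀ (by positivity)] at hHle; linarith
    have hη4 : 4 ≤ η * a := by
      have : η * a = 4 * (δ * s) := by rw [hη]; field_simp
      linarith
    have hHa : 32 * (H:ℝ) ≤ a := by
      have h1 : 32 * (H:ℝ) ≤ (8 * η * H) * a := by
        have := mul_le_mul_of_nonneg_right hη4 hH'.le
        linarith
      have h2 : (8 * η * H) * a ≤ 1 * a := by gcongr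
      linarith
    have hHN : ((2 * H * N : ℕ) : ℝ) ≤ K ^ 5 := by
      push_cast
      calc 2 * (H:ℝ) * N ≤ 2 * (a / 32) * (4 * (a * s)) := by
            gcongr; linarith
        _ ≤ a ^ 2 * s := by
            have : 0 ≤ a ^ 2 * s := by positivity
            linarith
        _ ≤ (K ^ 2) ^ 2 * K := by gcongr
        _ = K ^ 5 := by ring
    set D : ℝ := C0 * (K ^ 5) ^ (ε / 3) with hD
    have hdD : ∀ l ∈ Finset.Icc 1 (2 * H * N), (l.divisors.card : ℝ) ≤ D := by
      intro l hl
      obtain ⟨l1, l2⟩ := Finset.mem_Icc.mp hl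
      refine (hdiv l (by omega)).trans ?_
      rw [hD]
      have : (l:ℝ) ≤ K ^ 5 := le_trans (by exact_mod_cast l2) hHN
      gcongr
    have hK5 : 1 ≤ (K ^ 5) ^ (ε / 3) := Real.one_le_rpow (one_le_pow₀ hK) (by positivity)
    have hD1 : 1 ≤ D := one_le_mul_of_one_le_of_one_le hC0 hK5
    have hθ1 : 1 / a ^ 2 ≤ 1 := by
      rw [div_le_one (by positivity)]; exact one_le_pow₀ ha
    have hqc := quad_count (1 / a ^ 2) b η D (by positivity) hθ1 N H hN hHp hH8 hdD (by linarith)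
    rw [one_div_one_div] at hqc
    set Λ := 1 + Real.log (a ^ 2) with hΛ
    have hlog0 : 0 ≤ Real.log (a ^ 2) := Real.log_nonneg (one_le_pow₀ ha)
    have hΛ1 : 1 ≤ Λ := by linarith
    have hKε : 1 ≤ K ^ (ε / 3) := Real.one_le_rpow hK (by positivity)
    have hΛ2 : Λ ≤ C1 * K ^ (ε / 3) := by
      have h1 : Real.log (a ^ 2) ≤ 4 * Real.log K := by
        calc Real.log (a ^ 2) ≤ Real.log (K ^ 4) := by
              apply Real.log_le_log (by positivity)
              calc a ^ 2 ≤ (K ^ 2) ^ 2 := by gcongr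
                _ = K ^ 4 := by ring
          _ = 4 * Real.log K := by rw [Real.log_pow]; norm_num
      have h2 := Real.log_le_rpow_div (x := K) (ε := ε / 3) (by linarith) (by positivity)
      have h3 : C1 * K ^ (ε / 3) = K ^ (ε / 3) + 4 * (K ^ (ε / 3) / (ε / 3)) := by
        rw [hC1]; ring
      linarith
    have hDΛ : D * Λ ≤ C0 * C1 * (K ^ ε) ^ 2 := by
      calc D * Λ ≤ (C0 * (K ^ 5) ^ (ε / 3)) * (C1 * K ^ (ε / 3)) := by
            rw [← hD]; gcongr
        _ = C0 * C1 * ((K ^ 5) ^ (ε / 3) * K ^ (ε / 3)) := by ring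
        _ = _ := by
            congr 1
            rw [← Real.mul_rpow (by positivity) (by positivity), ← pow_succ, ← Real.rpow_natCast,
              ← Real.rpow_natCast, ← Real.rpow_mul (by positivity), ← Real.rpow_mul (by positivity)]
            congr 1; push_cast; ring
    have hDΛ1 : 1 ≤ D * Λ := one_le_mul_of_one_le_of_one_le hD1 hΛ1
    have hX : (N:ℝ) + 16 * D * (N * (1 / a ^ 2) + 1 / H) * (N + a ^ 2 * Λ) ≤
        4356 * (D * Λ) * (K + q) := by
      have e1 : (N:ℝ) * (1 / a ^ 2) + 1 / H ≤ 68 * q / a ^ 2 := by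
        have f1 : (N:ℝ) * (1 / a ^ 2) ≤ 4 * q * (1 / a ^ 2) := by gcongr
        have f2 : 16 * η ≤ 64 * q / a ^ 2 := by
          have : 64 * q / a ^ 2 = 64 * s / a := by rw [hq]; field_simp
          rw [this, hη, show 16 * (4 * δ * s / a) = 64 * (δ * s) / a by ring]
          gcongr
          exact mul_le_of_le_one_left (by linarith) hδ1
        have f3 : 4 * q * (1 / a ^ 2) + 64 * q / a ^ 2 = 68 * q / a ^ 2 := by ring
        linarith
      have e2 : (N:ℝ) + a ^ 2 * Λ ≤ Λ * (4 * q + a ^ 2) := by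
        have : 1 * (4 * q) ≤ Λ * (4 * q) := mul_le_mul_of_nonneg_right hΛ1 (by linarith)
        linarith
      have e3 : 68 * q / a ^ 2 * (Λ * (4 * q + a ^ 2)) = Λ * (272 * K + 68 * q) := by
        rw [hq, ← hss]; field_simp; ring
      calc (N:ℝ) + 16 * D * (N * (1 / a ^ 2) + 1 / H) * (N + a ^ 2 * Λ)
          ≤ 4 * q + 16 * D * (68 * q / a ^ 2) * (Λ * (4 * q + a ^ 2)) := by gcongr
        _ = 4 * q + 16 * D * (Λ * (272 * K + 68 * q)) := by rw [← e3]; ring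
        _ ≤ 4 * q * (D * Λ) + 16 * D * (Λ * (272 * K + 272 * q)) := by
            apply add_le_add
            · exact le_mul_of_one_le_right (by linarith) hDΛ1
            · gcongr
              norm_num
        _ ≤ _ := by
            have : 0 ≤ (D * Λ) * K := by positivity
            linarith
    have hsqrt : Real.sqrt ((N:ℝ) + 16 * D * (N * (1 / a ^ 2) + 1 / H) * (N + a ^ 2 * Λ)) ≤
        Real.sqrt (4356 * (C0 * C1)) * (K ^ ε * (s + Real.sqrt q)) := by
      calc _ ≤ Real.sqrt (4356 * (C0 * C1) * ((K ^ ε) ^ 2 * (K + q))) := by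
            apply Real.sqrt_le_sqrt
            refine hX.trans ?_
            calc 4356 * (D * Λ) * (K + q) ≤ 4356 * (C0 * C1 * (K ^ ε) ^ 2) * (K + q) := by gcongr
              _ = _ := by ring
        _ = Real.sqrt (4356 * (C0 * C1)) * (K ^ ε * Real.sqrt (K + q)) := by
            rw [Real.sqrt_mul (by positivity : 0 ≤ 4356 * (C0 * C1)),
              Real.sqrt_mul (by positivity : 0 ≤ (K ^ ε) ^ 2), Real.sqrt_sq (by positivity)]
        _ ≤ _ := by
            gcongr
            apply Real.sqrt_le_iff.mpr
            refine ⟨by positivity, ?_⟩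
            have g1 : Real.sqrt q * Real.sqrt q = q := Real.mul_self_sqrt (by linarith)
            have g2 : 0 ≤ s * Real.sqrt q := by positivity
            rw [add_sq, sq, sq, hss, g1]
            linarith
    have hNH : (N:ℝ) / H ≤ 256 * (K * δ) := by
      calc (N:ℝ) / H = N * (1 / H) := by ring
        _ ≤ (4 * q) * (16 * η) := by gcongr
        _ = _ := by linarith
    calc (S.card : ℝ) ≤ (2 * η + 1) * A.card := hcard
      _ ≤ 2 * A.card := by gcongr; linarith
      _ ≤ 2 * (4 * (256 * (K * δ)) + 8 * (Real.sqrt (4356 * (C0 * C1)) * (K ^ ε * (s + Real.sqrt q)))) := by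
          have : (A.card : ℝ) ≤ _ := hqc
          linarith
      _ ≤ _ := by
          have g1 : 0 ≤ Real.sqrt (4356 * (C0 * C1)) * (K * δ) := by positivity
          linarith

open scoped Classical in
theorem sqrt_nearest_integer_count :
    ∀ ε : ℝ, 0 < ε → ∃ C : ℝ, 0 < C ∧
      ∀ β α δ K : ℝ, 1 ≤ |α| → 0 < δ → δ < 1 / 2 → 1 ≤ K →
        (((Finset.Icc 1 ⌊2 * K⌋₊).filter
            (fun k : ℕ => K < (k : ℝ) ∧
              |(β + α * Real.sqrt k) - round (β + α * Real.sqrt k)| < δ)).card : ℝ) ≤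
          C * (K * δ + |α| ^ ((1 : ℝ) / 2) * K ^ (1 / 4 + ε : ℝ) + K ^ (1 / 2 + ε : ℝ)) := by
  intro ε hε
  obtain ⟨C, hC, hcore⟩ := core ε hε
  refine ⟨2 * C + 2, by positivity, ?_⟩
  intro β α δ K hα hδ hδ2 hK
  set S := (Finset.Icc 1 ⌊2 * K⌋₊).filter (fun k : ℕ => K < (k : ℝ) ∧
              |(β + α * Real.sqrt k) - round (β + α * Real.sqrt k)| < δ) with hS
  have hK0 : 0 < K := by linarith
  set a := |α| with ha
  have ha0 : 0 < a := by linarith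
  have t1 : 0 ≤ K * δ := by positivity
  have t2 : 0 ≤ a ^ ((1 : ℝ) / 2) * K ^ (1 / 4 + ε : ℝ) := by positivity
  have t3 : 0 ≤ K ^ (1 / 2 + ε : ℝ) := by positivity
  have hKε : 1 ≤ K ^ ε := Real.one_le_rpow hK hε.le
  have hsK : 1 ≤ Real.sqrt K := Real.one_le_sqrt.mpr hK
  have hss : Real.sqrt K * Real.sqrt K = K := Real.mul_self_sqrt (by linarith)
  have r3 : K ^ (1 / 2 + ε : ℝ) = K ^ ε * Real.sqrt K := by
    rw [Real.rpow_add hK0, Real.sqrt_eq_rpow, mul_comm]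
  have r2 : a ^ ((1 : ℝ) / 2) * K ^ (1 / 4 + ε : ℝ) = K ^ ε * Real.sqrt (a * Real.sqrt K) := by
    rw [Real.rpow_add hK0, Real.sqrt_mul ha0.le, Real.sqrt_eq_rpow, Real.sqrt_eq_rpow,
      Real.sqrt_eq_rpow, ← Real.rpow_mul hK0.le]
    norm_num; ring
  rcases le_or_gt a (K ^ 2) with hc | hc
  · set δ' := max δ (1 / Real.sqrt K) with hδ'
    have h1 : 1 / Real.sqrt K ≤ 1 := by rw [div_le_one (by positivity)]; exact hsK
    have hmem : ∀ k ∈ S, K < (k:ℝ) ∧ (k:ℝ) ≤ 2 * K ∧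
        |(β + α * Real.sqrt k) - round (β + α * Real.sqrt k)| < δ := by
      intro k hk
      obtain ⟨q1, q2, q3⟩ := Finset.mem_filter.mp hk
      refine ⟨q2, ?_, q3⟩
      exact (Nat.le_floor_iff (by positivity)).mp (Finset.mem_Icc.mp q1).2
    have hex : ∃ β', ∀ k ∈ S, K < (k:ℝ) ∧ (k:ℝ) ≤ 2 * K ∧
        |(β' + a * Real.sqrt k) - round (β' + a * Real.sqrt k)| < δ' := by
      rcases abs_choice α with h | h
      · refine ⟨β, fun k hk => ?_⟩
        obtain ⟨q1, q2, q3⟩ := hmem k hk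
        rw [ha, h]
        exact ⟨q1, q2, q3.trans_le (le_max_left _ _)⟩
      · refine ⟨-β, fun k hk => ?_⟩
        obtain ⟨q1, q2, q3⟩ := hmem k hk
        rw [ha, h]
        refine ⟨q1, q2, lt_of_le_of_lt ?_ (q3.trans_le (le_max_left _ _))⟩
        refine (round_le _ (-round (β + α * Real.sqrt k))).trans (le_of_eq ?_)
        rw [← abs_neg]; congr 1; push_cast; ring
    obtain ⟨β', hβ'⟩ := hex
    have hfin := hcore S β' a δ' K hα hc (lt_max_of_lt_left hδ) (max_le (by linarith) h1) hK
      (by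
        have : 1 / Real.sqrt K * Real.sqrt K ≤ δ' * Real.sqrt K := by
          gcongr; exact le_max_right _ _
        have h2 : 1 / Real.sqrt K * Real.sqrt K = 1 := by field_simp
        linarith) hβ'
    have hKδ' : K * δ' ≤ K * δ + Real.sqrt K := by
      have : δ' ≤ δ + 1 / Real.sqrt K := max_le (by linarith [show 0 ≤ 1 / Real.sqrt K by positivity]) (by linarith)
      have h2 : K * (1 / Real.sqrt K) = Real.sqrt K := by
        nth_rw 1 [← hss]; field_simp
      nlinarith
    have h4 : Real.sqrt K ≤ K ^ ε * Real.sqrt K := by nlinarith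
    rw [r3] at t3 ⊢
    rw [r2] at t2 ⊢
    refine hfin.trans ?_
    calc _ ≤ C * (2 * (K * δ + K ^ ε * Real.sqrt (a * Real.sqrt K) + K ^ ε * Real.sqrt K)) := by
          apply mul_le_mul_of_nonneg_left _ hC.le
          rw [mul_add]
          linarith
      _ ≤ _ := by nlinarith
  · have hcard : (S.card : ℝ) ≤ 2 * K := by
      have h1 : S.card ≤ ⌊2 * K⌋₊ := by
        have := Finset.card_filter_le (Finset.Icc 1 ⌊2 * K⌋₊) (fun k : ℕ => K < (k : ℝ) ∧
              |(β + α * Real.sqrt k) - round (β + α * Real.sqrt k)| < δ)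
        rw [Nat.card_Icc] at this
        simpa using this
      calc (S.card : ℝ) ≤ (⌊2 * K⌋₊ : ℝ) := by exact_mod_cast h1
        _ ≤ 2 * K := Nat.floor_le (by positivity)
    have hK2 : K ≤ a ^ ((1 : ℝ) / 2) * K ^ (1 / 4 + ε : ℝ) := by
      rw [r2]
      have : K ≤ Real.sqrt (a * Real.sqrt K) := by
        apply Real.le_sqrt_of_sq_le
        nlinarith
      nlinarith
    nlinarith
end

section
/- For every ε > 0 there is a constant C(ε) such that for every real Y ≥ 2: the sum of d(n)d(m)d(k)d(l)d(r)d(s)d(t)d(j)·(nmklrstj)^{−3/4} over all octuples (n,m,k,l,r,s,t,j) of positive integers satisfying √n+√m+√k+√l = √r+√s+√t+√j and max(n,m,k,l,r,s,t,j) > Y is at most C(ε)·Y^{−1/2+ε}. In particular, the full series over all octuples satisfying √n+√m+√k+√l = √r+√s+√t+√j (defining the constant C₇) converges. -/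
open Real MeasureTheory

/-- number of positive divisors of `n` -/
noncomputable def dd (n : ℕ) : ℝ := n.divisors.card

/-- the term attached to an octuple of positive integers -/
noncomputable def octTerm (p : Fin 8 → ℕ) : ℝ :=
  (∏ i, dd (p i)) * (∏ i, ((p i : ℝ))) ^ (-(3 : ℝ) / 4)

/-- `√n+√m+√k+√l+√r+√s = √t+√j` -/
def cond4 (p : Fin 8 → ℕ) : Prop :=
  Real.sqrt (p 0) + Real.sqrt (p 1) + Real.sqrt (p 2) + Real.sqrt (p 3) +
      Real.sqrt (p 4) + Real.sqrt (p 5) = Real.sqrt (p 6) + Real.sqrt (p 7)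

/-- `√n+√m+√k+√l = √r+√s+√t+√j` -/
def cond7 (p : Fin 8 → ℕ) : Prop :=
  Real.sqrt (p 0) + Real.sqrt (p 1) + Real.sqrt (p 2) + Real.sqrt (p 3) =
    Real.sqrt (p 4) + Real.sqrt (p 5) + Real.sqrt (p 6) + Real.sqrt (p 7)

noncomputable def C4 : ℝ :=
  ∑' p : {p : Fin 8 → ℕ // (∀ i, 0 < p i) ∧ cond4 p}, octTerm p.1

noncomputable def C7 : ℝ :=
  ∑' p : {p : Fin 8 → ℕ // (∀ i, 0 < p i) ∧ cond7 p}, octTerm p.1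

/-- the error term in the Dirichlet divisor problem -/
noncomputable def Δ (x : ℝ) : ℝ :=
  (∑ n ∈ Finset.Icc 1 ⌊x⌋₊, dd n) - x * Real.log x -
    (2 * Real.eulerMascheroniConstant - 1) * x

lemma sqrt_rel {ι : Type} [Fintype ι] (x : ι → ℕ) (hx : ∀ i, 0 < x i) (c : ι → ℤ)
    (h : ∑ i, (c i : ℝ) * √(x i) = 0) (i : ι) :
    ∃ S : Finset ι, i ∈ S ∧ (∀ j ∈ S, IsSquare (x i * x j)) ∧ ∑ j ∈ S, (c j : ℝ) * √(x j) = 0 := by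
  classical
  let K := algebraicClosure ℚ ℂ
  have : IsAlgClosure ℚ K := algebraicClosure.isAlgClosure ℚ ℂ
  have : IsGalois ℚ K := IsAlgClosure.isGalois ℚ K
  have hmem : ∀ j, ((√(x j) : ℝ) : ℂ) ∈ K := by
    intro j
    rw [mem_algebraicClosure_iff]
    apply IsAlgebraic.of_pow (n := 2) (by norm_num)
    have : (((√(x j) : ℝ) : ℂ)) ^ 2 = algebraMap ℚ ℂ (x j) := by
      rw [← Complex.ofReal_pow, Real.sq_sqrt (by positivity)]; simp
    rw [this]
    exact isAlgebraic_algebraMap _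
  let v : ι → K := fun j => ⟨_, hmem j⟩
  have hv : ∀ j, ((v j : K) : ℂ) = ((√(x j) : ℝ) : ℂ) := fun j => rfl
  have hv2 : ∀ j, v j ^ 2 = (x j : K) := by
    intro j
    apply Subtype.ext
    push_cast
    rw [hv, ← Complex.ofReal_pow, Real.sq_sqrt (by positivity)]; simp
  have hv0 : ∀ j, v j ≠ 0 := by
    intro j hj
    have := hv2 j
    rw [hj] at this
    have h2 : (x j : K) = 0 := by rw [← this]; simp
    have := hx j
    have h3 : x j = 0 := by exact_mod_cast h2
    omega
  have hs : ∀ (σ : K ≃ₐ[ℚ] K) j, σ (v j) = v j ∨ σ (v j) = - v j := by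
    intro σ j
    apply sq_eq_sq_iff_eq_or_eq_neg.mp
    rw [← map_pow, hv2]; simp
  let χ : ι → ((K ≃ₐ[ℚ] K) →* K) := fun j =>
    { toFun := fun σ => σ (v j) / v j
      map_one' := by simp [hv0]
      map_mul' := by
        intro σ τ
        have := hv0 j
        rcases hs σ j with h1 | h1 <;> rcases hs τ j with h2 | h2 <;> simp [h1, h2, this] }
  have hχ : ∀ j σ, χ j σ * v j = σ (v j) := fun j σ => div_mul_cancel₀ _ (hv0 j)
  have hχ2 : ∀ j σ, χ j σ * χ j σ = 1 := by
    intro j σ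
    change σ (v j) / v j * (σ (v j) / v j) = 1
    have := hv0 j
    rcases hs σ j with h1 | h1 <;> simp [h1, this]
  have hrel : ∑ j, (c j : K) * v j = 0 := by
    apply Subtype.ext
    have := congrArg (fun t : ℝ => (t : ℂ)) h
    push_cast at this ⊢
    simpa [hv] using this
  have hli := linearIndependent_iff'.mp (linearIndependent_monoidHom (K ≃ₐ[ℚ] K) K)
    (Finset.univ.image χ) (fun ψ => ∑ j ∈ Finset.univ.filter (fun j => χ j = ψ), (c j : K) * v j) (by
      funext σ
      simp only [Finset.sum_apply, Pi.smul_apply, smul_eq_mul, Pi.zero_apply]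
      have : ∀ ψ ∈ Finset.univ.image χ,
        (∑ j ∈ Finset.univ.filter (fun j => χ j = ψ), (c j : K) * v j) * ψ σ
        = ∑ j ∈ Finset.univ.filter (fun j => χ j = ψ), σ ((c j : K) * v j) := by
          intro ψ _
          rw [Finset.sum_mul]
          apply Finset.sum_congr rfl
          intro j hj
          rw [← (Finset.mem_filter.mp hj).2, map_mul, ← hχ j]
          simp
          ring
      rw [Finset.sum_congr rfl this, Finset.sum_fiberwise_of_maps_to (g := χ) (fun j _ => Finset.mem_image_of_mem _ (Finset.mem_univ _)), ← map_sum, hrel, map_zero])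
    (χ i) (Finset.mem_image_of_mem _ (Finset.mem_univ _))
  refine ⟨Finset.univ.filter (fun j => χ j = χ i), by simp, ?_, ?_⟩
  · intro j hj
    have hj := (Finset.mem_filter.mp hj).2
    have hfix : v i * v j ∈ (⊥ : IntermediateField ℚ K) := by
      rw [InfiniteGalois.mem_bot_iff_fixed]
      intro σ
      rw [map_mul, ← hχ i, ← hχ j, hj]
      linear_combination (v i * v j) * hχ2 i σ
    obtain ⟨r, hr⟩ := IntermediateField.mem_bot.mp hfix
    rw [← Rat.isSquare_natCast_iff]
    refine ⟨r, ?_⟩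
    apply (algebraMap ℚ K).injective
    rw [map_mul, hr]
    push_cast
    rw [← hv2, ← hv2]; ring
  · have := congrArg (fun t : K => (t : ℂ)) hli
    have h2 : ((∑ j ∈ Finset.univ.filter (fun j => χ j = χ i), (c j : ℝ) * √(x j) : ℝ) : ℂ) = 0 := by
      push_cast at this ⊢
      simpa [hv] using this
    exact_mod_cast h2

lemma summable_prod_fin (f : ℕ → ℝ) (hf : ∀ n, 0 ≤ f n) (hs : Summable f) (n : ℕ) :
    Summable (fun p : Fin n → ℕ => ∏ i, f (p i)) := by
  induction n with
  | zero => exact Summable.of_finite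
  | succ n ih =>
    have := hs.mul_of_nonneg ih hf (fun p => Finset.prod_nonneg fun i _ => hf _)
    rw [← (Fin.consEquiv (fun _ : Fin (n+1) => ℕ)).summable_iff]
    convert this using 2 with q
    simp [Fin.prod_univ_succ]

lemma dd_bound (δ : ℝ) (hδ : 0 < δ) : ∃ C : ℝ, 0 < C ∧ ∀ n : ℕ, 0 < n →
    (n.divisors.card : ℝ) ≤ C * (n : ℝ) ^ δ := by
  set c := δ * Real.log 2 with hc
  have hc0 : 0 < c := mul_pos hδ (Real.log_pos (by norm_num))
  set A := 1 + 1 / c with hA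
  have hA1 : 1 ≤ A := by rw [hA]; have : 0 < 1 / c := by positivity
                         linarith
  set M := ⌈(2:ℝ) ^ (1 / δ)⌉₊ with hM
  refine ⟨A ^ M, by positivity, ?_⟩
  intro n hn
  rw [Nat.card_divisors hn.ne']
  push_cast
  have hnp : (n : ℝ) ^ δ = ∏ p ∈ n.primeFactors, ((p : ℝ) ^ (n.factorization p)) ^ δ := by
    rw [Real.finsetProd_rpow _ _ (fun i _ => by positivity)]
    congr 1
    conv_lhs => rw [← Nat.prod_factorization_pow_eq_self hn.ne']
    rw [Finsupp.prod]
    push_cast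
    rfl
  have hAp : ∏ p ∈ n.primeFactors, (if p < M then A else 1) ≤ A ^ M := by
    rw [← Finset.prod_filter, Finset.prod_const]
    apply pow_le_pow_right₀ hA1
    calc _ ≤ (Finset.range M).card := Finset.card_le_card (by
            intro p hp; simp at hp ⊢; exact hp.2)
      _ = M := by simp
  calc _ ≤ ∏ p ∈ n.primeFactors, ((if p < M then A else 1) * ((p : ℝ) ^ (n.factorization p)) ^ δ) := by
        apply Finset.prod_le_prod
        · intros; positivity
        · intro p hp
          have hp2 : (2:ℝ) ≤ p := by exact_mod_cast (Nat.prime_of_mem_primeFactors hp).two_le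
          generalize n.factorization p = e
          rw [← Real.rpow_natCast, ← Real.rpow_mul (by positivity), mul_comm (e:ℝ) δ, Real.rpow_mul (by positivity)]
          split_ifs with h
          · have : 1 + c * e ≤ ((p:ℝ) ^ δ) ^ (e:ℝ) := by
              calc 1 + c * e ≤ Real.exp (c * e) := by linarith [Real.add_one_le_exp (c * e)]
                _ = ((2:ℝ) ^ δ) ^ (e:ℝ) := by
                  rw [← Real.rpow_mul (by norm_num), Real.rpow_def_of_pos (by norm_num)]
                  congr 1; rw [hc]; ring
                _ ≤ _ := by gcongr
            calc (e:ℝ) + 1 ≤ A * (1 + c * e) := by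
                  have : A * (1 + c * e) = 1 + c * e + 1 / c + e := by rw [hA]; field_simp; ring
                  rw [this]
                  have : 0 < 1 / c := by positivity
                  have : 0 ≤ c * e := by positivity
                  linarith
              _ ≤ _ := by gcongr
          · have h1 : (2:ℝ) ≤ (p:ℝ) ^ δ := by
              have : (2:ℝ) ^ (1/δ) ≤ p := (Nat.le_ceil _).trans (by exact_mod_cast not_lt.mp h)
              calc (2:ℝ) = ((2:ℝ) ^ (1/δ)) ^ δ := by
                    rw [← Real.rpow_mul (by norm_num)]; field_simp; simp
                _ ≤ _ := by gcongr
            rw [Real.rpow_natCast, one_mul]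
            calc (e:ℝ) + 1 ≤ 2 ^ e := by exact_mod_cast Nat.lt_two_pow_self
              _ ≤ _ := by gcongr
    _ ≤ _ := by
      rw [Finset.prod_mul_distrib, ← hnp]
      gcongr

def goodT : Set (Fin 8 → ℕ) := {p | (∀ i, 0 < p i) ∧ ∀ i, ∃ j, j ≠ i ∧ IsSquare (p i * p j)}

lemma sqfree_eq {a b : ℕ} (ha : Squarefree a) (hb : Squarefree b) (h : IsSquare (a * b)) : a = b := by
  have key : ∀ a b : ℕ, Squarefree a → IsSquare (a * b) → a ∣ b := by
    intro a b ha ⟨c, hc⟩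
    have : a ∣ c ^ 2 := ⟨b, by rw [hc]; ring⟩
    have h1 : a ∣ c := (ha.dvd_pow_iff_dvd (by norm_num)).mp this
    have h2 : a * a ∣ a * b := hc ▸ mul_dvd_mul h1 h1
    exact Nat.dvd_of_mul_dvd_mul_left (Nat.pos_of_ne_zero ha.ne_zero) h2
  exact Nat.dvd_antisymm (key a b ha h) (key b a hb (by rwa [mul_comm]))

lemma summable_good (s : ℝ) (hs : 1 / 2 < s) :
    Summable (fun p : goodT => ∏ i, ((p.1 i : ℕ) : ℝ) ^ (-s)) := by
  classical
  have h0 : Summable (fun n : ℕ => (n : ℝ) ^ (-(2 * s))) :=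
    Real.summable_nat_rpow.mpr (by linarith)
  have h1 := summable_prod_fin _ (fun n => by positivity) h0 8
  have h2 := h1.mul_of_nonneg h1 (fun p => Finset.prod_nonneg fun i _ => by positivity)
    (fun p => Finset.prod_nonneg fun i _ => by positivity)
  have h3 : Summable (fun _ : Fin 8 → Fin 8 => (1:ℝ)) := Summable.of_finite
  have h4 := h3.mul_of_nonneg h2 (fun _ => zero_le_one) (fun p => mul_nonneg
    (Finset.prod_nonneg fun i _ => by positivity) (Finset.prod_nonneg fun i _ => by positivity))
  have key : ∀ p : goodT, ∃ (w : (Fin 8 → Fin 8) × (Fin 8 → ℕ) × (Fin 8 → ℕ)),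
      (∀ i, p.1 i = w.2.1 (w.1 i) * w.2.2 i ^ 2) ∧
      ∏ i, ((p.1 i : ℕ) : ℝ) ^ (-s) ≤
        1 * ((∏ i, ((w.2.1 i : ℕ) : ℝ) ^ (-(2*s))) * ∏ i, ((w.2.2 i : ℕ) : ℝ) ^ (-(2*s))) := by
    rintro ⟨p, hp, hsq⟩
    choose q a hqa hq using fun i => Nat.sq_mul_squarefree (p i)
    have ha0 : ∀ i, 0 < a i := by
      intro i
      rcases Nat.eq_zero_or_pos (a i) with h | h
      · have h5 := hp i
        rw [← hqa i, h] at h5; simp at h5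
      · exact h
    have hcls : ∀ i, ∃ j, j ≠ i ∧ q j = q i := by
      intro i
      obtain ⟨j, hj, c, hc⟩ := hsq i
      refine ⟨j, hj, (sqfree_eq (hq i) (hq j) ?_).symm⟩
      rw [← hqa i, ← hqa j] at hc
      have hd : (a i * a j) ^ 2 ∣ c ^ 2 := ⟨q i * q j, by linear_combination -hc⟩
      obtain ⟨e, he⟩ := (Nat.pow_dvd_pow_iff (by norm_num)).mp hd
      refine ⟨e, ?_⟩
      have hpos : 0 < (a i * a j) ^ 2 := by have := ha0 i; have := ha0 j; positivity
      apply Nat.eq_of_mul_eq_mul_left hpos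
      rw [he] at hc
      linear_combination hc
    let ρ : Fin 8 → Fin 8 := fun i => Function.invFun q (q i)
    have hρ : ∀ i, q (ρ i) = q i := fun i => Function.invFun_eq ⟨i, rfl⟩
    have hρ2 : ∀ i j, q i = q j → ρ i = ρ j := fun i j h => by simp only [ρ, h]
    let g : Fin 8 → ℕ := fun k => if ∃ i, ρ i = k then q k else 1
    have hg : ∀ i, g (ρ i) = q i := fun i => by
      simp only [g]; rw [if_pos ⟨i, rfl⟩, hρ]
    have hg1 : ∀ k, 1 ≤ g k := by
      intro k
      simp only [g]; split_ifs
      · exact Nat.pos_of_ne_zero (hq k).ne_zero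
      · exact le_rfl
    refine ⟨(ρ, g, a), fun i => by simp only [hg]; rw [← hqa i]; ring, ?_⟩
    simp only [one_mul]
    have e1 : ∏ i, ((p i : ℕ) : ℝ) ^ (-s) =
        (∏ i, (g (ρ i) : ℝ) ^ (-s)) * ∏ i, (a i : ℝ) ^ (-(2*s)) := by
      rw [← Finset.prod_mul_distrib]
      apply Finset.prod_congr rfl
      intro i _
      rw [hg, ← hqa i]
      push_cast
      rw [Real.mul_rpow (by positivity) (by positivity), ← Real.rpow_natCast, ← Real.rpow_mul (by positivity), mul_comm]
      congr 2; push_cast; ring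
    rw [e1]
    refine mul_le_mul_of_nonneg_right ?_ (Finset.prod_nonneg fun i _ => by positivity)
    rw [← Finset.prod_fiberwise (g := ρ)]
    apply Finset.prod_le_prod
    · intros; exact Finset.prod_nonneg fun i _ => by positivity
    intro k _
    have hk1 : (1:ℝ) ≤ g k := by exact_mod_cast hg1 k
    have e2 : ∏ i ∈ Finset.univ.filter (fun i => ρ i = k), (g (ρ i) : ℝ) ^ (-s)
        = ((g k : ℝ) ^ (-s)) ^ (Finset.univ.filter (fun i => ρ i = k)).card := by
      rw [← Finset.prod_const]
      apply Finset.prod_congr rfl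
      intro i hi
      rw [(Finset.mem_filter.mp hi).2]
    rw [e2]
    by_cases hk : ∃ i, ρ i = k
    · obtain ⟨i, rfl⟩ := hk
      obtain ⟨j, hji, hj⟩ := hcls i
      have hcard : 2 ≤ (Finset.univ.filter (fun l => ρ l = ρ i)).card := by
        have : ({i, j} : Finset (Fin 8)).card = 2 := Finset.card_pair hji.symm
        rw [← this]
        apply Finset.card_le_card
        intro l hl
        simp only [Finset.mem_insert, Finset.mem_singleton] at hl
        rcases hl with rfl | rfl
        · simp
        · simp [hρ2 _ _ hj]
      calc _ ≤ ((g (ρ i) : ℝ) ^ (-s)) ^ 2 := by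
            apply pow_le_pow_of_le_one (by positivity) _ hcard
            exact Real.rpow_le_one_of_one_le_of_nonpos hk1 (by linarith)
        _ = _ := by
          rw [← Real.rpow_natCast, ← Real.rpow_mul (by positivity)]
          congr 1; push_cast; ring
    · have : g k = 1 := by simp only [g]; rw [if_neg hk]
      simp [this]
  choose w hw1 hw2 using key
  have hinj : Function.Injective w := by
    intro p p' h
    apply Subtype.ext
    funext i
    rw [hw1, hw1, h]
  exact Summable.of_nonneg_of_le (fun p => Finset.prod_nonneg fun i _ => by positivity) hw2
    (h4.comp_injective hinj)

lemma cond_partner (p : Fin 8 → ℕ) (hp : ∀ i, 0 < p i) (h : cond7 p) (i : Fin 8) :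
    ∃ j, j ≠ i ∧ IsSquare (p i * p j) ∧ p i ≤ 49 * p j := by
  classical
  let c : Fin 8 → ℤ := ![1, 1, 1, 1, -1, -1, -1, -1]
  have hc : ∀ j, |(c j : ℝ)| = 1 := by
    intro j; fin_cases j <;> simp [c]
  obtain ⟨S, hiS, hS, hsum⟩ := sqrt_rel p hp c (by
    unfold cond7 at h
    simp only [Fin.sum_univ_eight, c]
    simp
    linarith) i
  have hle : √(p i) ≤ ∑ j ∈ S.erase i, √(p j) := by
    rw [← Finset.add_sum_erase _ _ hiS] at hsum
    have h1 : (c i : ℝ) * √(p i) = - ∑ j ∈ S.erase i, (c j : ℝ) * √(p j) := by linarith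
    calc √(p i) = |(c i : ℝ) * √(p i)| := by
          rw [abs_mul, hc, one_mul, abs_of_nonneg (Real.sqrt_nonneg _)]
      _ = |∑ j ∈ S.erase i, (c j : ℝ) * √(p j)| := by rw [h1, abs_neg]
      _ ≤ ∑ j ∈ S.erase i, |(c j : ℝ) * √(p j)| := Finset.abs_sum_le_sum_abs _ _
      _ = _ := by
        apply Finset.sum_congr rfl
        intro j _
        rw [abs_mul, hc, one_mul, abs_of_nonneg (Real.sqrt_nonneg _)]
  have hpos : 0 < √(p i : ℝ) := Real.sqrt_pos.mpr (by exact_mod_cast hp i)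
  by_contra hcon
  push Not at hcon
  have hne : (S.erase i).Nonempty := by
    rw [Finset.nonempty_iff_ne_empty]
    intro he
    rw [he] at hle
    rw [Finset.sum_empty] at hle
    linarith
  have hlt : ∑ j ∈ S.erase i, √(p j : ℝ) < ∑ j ∈ S.erase i, √(p i : ℝ) / 7 := by
    apply Finset.sum_lt_sum_of_nonempty hne
    intro j hj
    have hj' := Finset.mem_erase.mp hj
    have h2 : (49 * p j : ℝ) < p i := by exact_mod_cast hcon j hj'.1 (hS j hj'.2)
    have h3 : √(49 * p j : ℝ) < √(p i) := Real.sqrt_lt_sqrt (by positivity) h2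
    rw [Real.sqrt_mul (by norm_num), show (49:ℝ) = 7 ^ 2 by norm_num, Real.sqrt_sq (by norm_num)] at h3
    linarith
  rw [Finset.sum_const, nsmul_eq_mul] at hlt
  have hcard : ((S.erase i).card : ℝ) ≤ 7 := by
    have h4 : (S.erase i).card ≤ (Finset.univ.erase i).card :=
      Finset.card_le_card (Finset.erase_subset_erase _ (Finset.subset_univ _))
    rw [Finset.card_erase_of_mem (Finset.mem_univ i)] at h4
    simp at h4
    exact_mod_cast h4
  nlinarith

lemma octTerm_bound (ε : ℝ) (h0 : 0 < ε) (h1 : ε ≤ 1 / 2) : ∃ C : ℝ, 0 < C ∧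
    ∀ p : Fin 8 → ℕ, (∀ i, 0 < p i) → cond7 p →
      octTerm p ≤ C * ((Finset.univ.sup p : ℕ) : ℝ) ^ (-1 / 2 + ε) *
        ∏ i, ((p i : ℕ) : ℝ) ^ (-(1 / 2 + ε / 4)) := by
  obtain ⟨C, hC, hd⟩ := dd_bound (ε / 4) (by linarith)
  refine ⟨C ^ 8 * 49, by positivity, ?_⟩
  intro p hp hc
  obtain ⟨i, -, hi⟩ := Finset.exists_mem_eq_sup Finset.univ Finset.univ_nonempty p
  rw [hi]
  obtain ⟨j, hji, -, hj⟩ := cond_partner p hp hc i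
  have hP : p i * p j ≤ ∏ k, p k := by
    rw [← Finset.prod_pair hji.symm]
    exact Finset.prod_le_prod_of_subset_of_one_le' (Finset.subset_univ _) (fun k _ _ => hp k)
  have hM : (0:ℝ) < p i := by exact_mod_cast hp i
  have hP2 : (p i : ℝ) ^ 2 / 49 ≤ ∏ k, (p k : ℝ) := by
    have a1 : (p i : ℝ) * p j ≤ ∏ k, (p k : ℝ) := by exact_mod_cast hP
    have a2 : (p i : ℝ) ≤ 49 * p j := by exact_mod_cast hj
    nlinarith
  have hprod : ∏ k, (p k : ℝ) ^ (-(1 / 2 + ε / 4)) = (∏ k, (p k : ℝ)) ^ (-(1 / 2 + ε / 4)) :=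
    Real.finsetProd_rpow _ _ (fun k _ => by positivity) _
  have hdd : ∏ k, dd (p k) ≤ C ^ 8 * (∏ k, (p k : ℝ)) ^ (ε / 4) := by
    calc _ ≤ ∏ k, (C * (p k : ℝ) ^ (ε / 4)) :=
          Finset.prod_le_prod (fun k _ => Nat.cast_nonneg _) (fun k _ => hd _ (hp k))
      _ = _ := by
        rw [Finset.prod_mul_distrib, Real.finsetProd_rpow _ _ (fun k _ => by positivity)]
        simp
  rw [hprod]
  unfold octTerm
  set P := ∏ k, (p k : ℝ) with hPdef
  have hP0 : 0 < P := lt_of_lt_of_le (by positivity) hP2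
  have hkey : P ^ (-1/4 + ε / 2) ≤ 49 * (p i : ℝ) ^ (-1/2 + ε) := by
    calc _ ≤ ((p i : ℝ) ^ 2 / 49) ^ (-1/4 + ε/2) :=
          Real.rpow_le_rpow_of_nonpos (by positivity) hP2 (by linarith)
      _ = (49:ℝ) ^ (1/4 - ε/2) * (p i : ℝ) ^ (-1/2 + ε) := by
        rw [div_eq_mul_inv, Real.mul_rpow (by positivity) (by positivity), Real.inv_rpow (by positivity),
          ← Real.rpow_neg (by positivity), ← Real.rpow_natCast, ← Real.rpow_mul (by positivity), mul_comm]
        congr 2 <;> (push_cast; ring)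
      _ ≤ (49:ℝ) ^ (1:ℝ) * (p i : ℝ) ^ (-1/2 + ε) := by
        gcongr
        · norm_num
        · linarith
      _ = _ := by rw [Real.rpow_one]
  calc _ ≤ C ^ 8 * P ^ (ε / 4) * P ^ (-(3:ℝ)/4) := by gcongr
    _ = C ^ 8 * P ^ (-1/4 + ε / 2) * P ^ (-(1 / 2 + ε / 4)) := by
      rw [mul_assoc, mul_assoc, ← Real.rpow_add hP0, ← Real.rpow_add hP0]
      congr 2; ring
    _ ≤ C ^ 8 * (49 * (p i : ℝ) ^ (-1/2 + ε)) * P ^ (-(1 / 2 + ε / 4)) := by gcongr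
    _ = _ := by ring

lemma mem_goodT (p : Fin 8 → ℕ) (hp : ∀ i, 0 < p i) (h : cond7 p) : p ∈ goodT :=
  ⟨hp, fun i => by
    obtain ⟨j, h1, h2, -⟩ := cond_partner p hp h i
    exact ⟨j, h1, h2⟩⟩

lemma octTerm_nonneg (p : Fin 8 → ℕ) : 0 ≤ octTerm p := by
  unfold octTerm dd; positivity

lemma octTerm_summable :
    Summable (fun p : {p : Fin 8 → ℕ // (∀ i, 0 < p i) ∧ cond7 p} => octTerm p.1) := by
  obtain ⟨C, hC, hb⟩ := octTerm_bound (1/2) (by norm_num) le_rfl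
  have hs := (summable_good (1 / 2 + (1/2) / 4) (by norm_num)).mul_left C
  let e : {p : Fin 8 → ℕ // (∀ i, 0 < p i) ∧ cond7 p} → goodT :=
    fun p => ⟨p.1, mem_goodT p.1 p.2.1 p.2.2⟩
  have he : Function.Injective e := fun a b h => Subtype.ext (congrArg (fun t : goodT => t.1) h)
  refine Summable.of_nonneg_of_le (fun p => octTerm_nonneg _) (fun p => ?_) (hs.comp_injective he)
  have := hb p.1 p.2.1 p.2.2
  rw [show (-1/2 + 1/2 : ℝ) = 0 by norm_num, Real.rpow_zero, mul_one] at this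
  exact this

lemma tail_summable (Y : ℝ) : Summable (fun p : {p : Fin 8 → ℕ //
      (∀ i, 0 < p i) ∧ cond7 p ∧ Y < ((Finset.univ.sup p : ℕ) : ℝ)} => octTerm p.1) := by
  have he : Function.Injective (fun p : {p : Fin 8 → ℕ //
      (∀ i, 0 < p i) ∧ cond7 p ∧ Y < ((Finset.univ.sup p : ℕ) : ℝ)} =>
      (⟨p.1, p.2.1, p.2.2.1⟩ : {p : Fin 8 → ℕ // (∀ i, 0 < p i) ∧ cond7 p})) := by
    intro a b h
    apply Subtype.ext
    simpa using h
  have := octTerm_summable.comp_injective he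
  simpa only [Function.comp_def] using this

lemma tail_aux (ε : ℝ) (h0 : 0 < ε) (h1 : ε ≤ 1 / 2) : ∃ C : ℝ, 0 < C ∧
      ∀ Y : ℝ, 2 ≤ Y →
        (∑' p : {p : Fin 8 → ℕ //
            (∀ i, 0 < p i) ∧ cond7 p ∧ Y < ((Finset.univ.sup p : ℕ) : ℝ)}, octTerm p.1) ≤
          C * Y ^ (-1 / 2 + ε : ℝ) := by
  obtain ⟨C, hC, hb⟩ := octTerm_bound ε h0 h1
  have hs := summable_good (1 / 2 + ε / 4) (by linarith)
  have hT : 0 ≤ ∑' p : goodT, ∏ i, ((p.1 i : ℕ) : ℝ) ^ (-(1 / 2 + ε / 4)) :=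
    tsum_nonneg fun p => Finset.prod_nonneg fun i _ => by positivity
  obtain ⟨T, hTd⟩ : ∃ T : ℝ, T = ∑' p : goodT, ∏ i, ((p.1 i : ℕ) : ℝ) ^ (-(1 / 2 + ε / 4)) := ⟨_, rfl⟩
  rw [← hTd] at hT
  refine ⟨C * (T + 1), by positivity, ?_⟩
  intro Y hY
  have hYp : 0 ≤ Y := by linarith
  let e : {p : Fin 8 → ℕ //
      (∀ i, 0 < p i) ∧ cond7 p ∧ Y < ((Finset.univ.sup p : ℕ) : ℝ)} → goodT :=
    fun p => ⟨p.1, mem_goodT p.1 p.2.1 p.2.2.1⟩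
  have he : Function.Injective e := fun a b h => Subtype.ext (congrArg (fun t : goodT => t.1) h)
  have hsum1 := tail_summable Y
  have hsum2 := hs.mul_left (C * Y ^ (-1 / 2 + ε : ℝ))
  have hY0 : 0 ≤ C * Y ^ (-1 / 2 + ε : ℝ) := mul_nonneg hC.le (Real.rpow_nonneg hYp _)
  have hmain := Summable.tsum_le_tsum_of_inj (f := fun p : {p : Fin 8 → ℕ //
      (∀ i, 0 < p i) ∧ cond7 p ∧ Y < ((Finset.univ.sup p : ℕ) : ℝ)} => octTerm p.1)
    (g := fun p : goodT => C * Y ^ (-1 / 2 + ε : ℝ) * ∏ i, ((p.1 i : ℕ) : ℝ) ^ (-(1 / 2 + ε / 4)))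
    e he (fun p _ => mul_nonneg hY0 (Finset.prod_nonneg fun i _ => by positivity))
    (fun p => by
      refine (hb p.1 p.2.1 p.2.2.1).trans ?_
      apply mul_le_mul_of_nonneg_right _ (Finset.prod_nonneg fun i _ => by positivity)
      apply mul_le_mul_of_nonneg_left _ hC.le
      exact Real.rpow_le_rpow_of_nonpos (by linarith) p.2.2.2.le (by linarith))
    hsum1 hsum2
  rw [tsum_mul_left, ← hTd] at hmain
  refine hmain.trans ?_
  have hY1 : 0 ≤ Y ^ (-1 / 2 + ε : ℝ) := Real.rpow_nonneg hYp _
  nlinarith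

theorem tail_sum_C7 :
    Summable (fun p : {p : Fin 8 → ℕ // (∀ i, 0 < p i) ∧ cond7 p} => octTerm p.1) ∧
    ∀ ε : ℝ, 0 < ε → ∃ C : ℝ, 0 < C ∧
      ∀ Y : ℝ, 2 ≤ Y →
        (∑' p : {p : Fin 8 → ℕ //
            (∀ i, 0 < p i) ∧ cond7 p ∧ Y < ((Finset.univ.sup p : ℕ) : ℝ)}, octTerm p.1) ≤
          C * Y ^ (-1 / 2 + ε : ℝ) := by
  refine ⟨octTerm_summable, ?_⟩
  intro ε hε
  obtain ⟨C, hC, h⟩ := tail_aux (min ε (1 / 2)) (lt_min hε (by norm_num)) (min_le_right _ _)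
  refine ⟨C, hC, fun Y hY => (h Y hY).trans ?_⟩
  have h2 : min ε (1 / 2) ≤ ε := min_le_left _ _
  exact mul_le_mul_of_nonneg_left
    (Real.rpow_le_rpow_of_exponent_le (by linarith) (by linarith)) hC.le
end

section
/- There is an absolute constant C such that for all real H ≥ 10 and all real Y with 2 ≤ Y ≤ H: ∫_H^{2H} ( x^{1/4} ∑_{Y < n ≤ H} d(n)·n^{−3/4}·cos(4π√(nx) − π/4) )^2 dx ≤ C · H^{3/2} · (log H)^3 · Y^{−1/2}, the inner sum being over integers n. -/
open Real MeasureTheory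

/-- `R_{Y,X}(x) = x^{1/4} ∑_{Y < n ≤ X} d(n) n^{-3/4} cos(4π√(nx) - π/4)` -/
noncomputable def RYX (Y X x : ℝ) : ℝ :=
  x ^ ((1 : ℝ) / 4) * ∑ n ∈ Finset.Ioc ⌊Y⌋₊ ⌊X⌋₊,
    dd n * (n : ℝ) ^ (-(3 : ℝ) / 4) * Real.cos (4 * Real.pi * Real.sqrt (n * x) - Real.pi / 4)

lemma ker_off (B ω : ℝ) (hB : 0 ≤ B) (hω : ω ≠ 0) :
    ∫ u in (0:ℝ)..B, u * (B - u) * cos (ω * u) ≤ 4 * B / ω ^ 2 := by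
  have hd : ∀ u ∈ Set.uIcc (0:ℝ) B, HasDerivAt
      (fun u => u * (B - u) * (sin (ω * u) / ω) + (B - 2 * u) * (cos (ω * u) / ω ^ 2)
        + 2 * sin (ω * u) / ω ^ 3) (u * (B - u) * cos (ω * u)) u := by
    intro u _
    have h0 : HasDerivAt (fun u : ℝ => ω * u) ω u := by
      simpa using (hasDerivAt_id u).const_mul ω
    have hs := h0.sin
    have hc := h0.cos
    have h1 : HasDerivAt (fun u : ℝ => B - u) (-1) u := by
      simpa using (hasDerivAt_id u).const_sub B
    have h2 : HasDerivAt (fun u : ℝ => B - 2 * u) (-2) u := by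
      simpa using ((hasDerivAt_id u).const_mul 2).const_sub B
    have := ((((hasDerivAt_id u).mul h1).mul (hs.div_const ω)).add
      (h2.mul (hc.div_const (ω ^ 2)))).add ((hs.const_mul 2).div_const (ω ^ 3))
    refine HasDerivAt.congr_deriv (this : HasDerivAt (fun u => u * (B - u) * (sin (ω * u) / ω)
      + (B - 2 * u) * (cos (ω * u) / ω ^ 2) + 2 * sin (ω * u) / ω ^ 3) _ u) ?_
    simp only [id, Pi.mul_apply]
    field_simp
    ring
  rw [intervalIntegral.integral_eq_sub_of_hasDerivAt hd
    (Continuous.intervalIntegrable (by fun_prop) _ _)]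
  simp only [mul_zero, sin_zero, cos_zero, sub_zero, sub_self, zero_mul, zero_div, add_zero, zero_add]
  have hs : sin (ω * B) / ω ≤ B := by
    have h1 : |sin (ω * B)| ≤ |ω * B| := Real.abs_sin_le_abs
    calc sin (ω * B) / ω ≤ |sin (ω * B) / ω| := le_abs_self _
      _ = |sin (ω * B)| / |ω| := abs_div _ _
      _ ≤ |ω * B| / |ω| := by gcongr
      _ = B := by
        rw [abs_mul, abs_of_nonneg hB]
        have : |ω| ≠ 0 := abs_ne_zero.mpr hω
        field_simp
  have hc : -1 ≤ cos (ω * B) := neg_one_le_cos _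
  have e : (B - 2 * B) * (cos (ω * B) / ω ^ 2) + 2 * sin (ω * B) / ω ^ 3 - B * (1 / ω ^ 2)
      = (-B * cos (ω * B) + 2 * (sin (ω * B) / ω) - B) / ω ^ 2 := by
    field_simp
    ring
  rw [e]
  gcongr
  nlinarith

lemma ker_diag (B : ℝ) (hB : 0 ≤ B) :
    ∫ u in (0:ℝ)..B, u * (B - u) ≤ B ^ 3 := by
  have : ∀ u ∈ Set.Icc (0:ℝ) B, u * (B - u) ≤ B ^ 2 := by
    intro u hu; nlinarith [hu.1, hu.2]
  calc _ ≤ ∫ u in (0:ℝ)..B, B ^ 2 := intervalIntegral.integral_mono_on hB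
        (Continuous.intervalIntegrable (by fun_prop) _ _)
        (Continuous.intervalIntegrable (by fun_prop) _ _) this
    _ = B ^ 3 := by simp; ring

noncomputable def gg (m n : ℕ) : ℝ := if m = n then 1 else 1 / ((m : ℝ) - n) ^ 2

lemma gg_comm (m n : ℕ) : gg m n = gg n m := by
  unfold gg
  rw [show ((m : ℝ) - n) ^ 2 = ((n : ℝ) - m) ^ 2 by ring]
  simp only [eq_comm]

lemma gg_nonneg (m n : ℕ) : 0 ≤ gg m n := by
  unfold gg; split_ifs <;> positivity

lemma ker_bound (H : ℝ) (hH : 1 ≤ H) (m n : ℕ) (hm : (m : ℝ) ≤ H) (hn : (n : ℝ) ≤ H) :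
    ∫ u in (0:ℝ)..(3 * √H), u * (3 * √H - u) * cos ((4 * π * √m - 4 * π * √n) * u)
      ≤ 27 * (H * √H) * gg m n := by
  have hs : √H ^ 2 = H := Real.sq_sqrt (by linarith)
  have hs1 : 0 < √H := Real.sqrt_pos.mpr (by linarith)
  unfold gg
  split_ifs with h
  · subst h
    simp only [sub_self, zero_mul, cos_zero, mul_one]
    refine (ker_diag _ (by positivity)).trans (le_of_eq ?_)
    rw [← hs]; simp; ring
  · have hp : √(m:ℝ) ^ 2 = m := Real.sq_sqrt (by positivity)
    have hq : √(n:ℝ) ^ 2 = n := Real.sq_sqrt (by positivity)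
    have hmn : (m : ℝ) - n ≠ 0 := sub_ne_zero.mpr (by exact_mod_cast h)
    have hpq : √(m:ℝ) - √n ≠ 0 := by
      intro h0; apply hmn; rw [← hp, ← hq, sub_eq_zero.mp h0, sub_self]
    have hω : 4 * π * √m - 4 * π * √n ≠ 0 := by
      rw [← mul_sub]; exact mul_ne_zero (by positivity) hpq
    refine (ker_off _ _ (by positivity) hω).trans ?_
    have hsum : √(m:ℝ) + √n ≤ 2 * √H := by
      have := Real.sqrt_le_sqrt hm
      have := Real.sqrt_le_sqrt hn
      linarith
    have e1 : ((m : ℝ) - n) ^ 2 ≤ 4 * H * (√(m:ℝ) - √n) ^ 2 := by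
      calc ((m : ℝ) - n) ^ 2 = (√(m:ℝ) + √n) ^ 2 * (√(m:ℝ) - √n) ^ 2 := by
            rw [← mul_pow, ← hp, ← hq]; simp only [Real.sqrt_sq (Real.sqrt_nonneg _)]; ring
        _ ≤ (2 * √H) ^ 2 * (√(m:ℝ) - √n) ^ 2 := by gcongr
        _ = _ := by rw [mul_pow, hs]; ring
    have e2 : (4 * π * √(m:ℝ) - 4 * π * √n) ^ 2 = 16 * π ^ 2 * (√(m:ℝ) - √n) ^ 2 := by ring
    rw [e2]
    have hpos : 0 < (√(m:ℝ) - √n) ^ 2 := by positivity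
    have hpos2 : 0 < ((m:ℝ) - n) ^ 2 := by positivity
    have hpi : 1 ≤ π ^ 2 := by nlinarith [Real.pi_gt_three]
    rw [mul_one_div, div_le_div_iff₀ (by positivity) hpos2]
    calc 4 * (3 * √H) * ((m:ℝ) - n) ^ 2 ≤ 4 * (3 * √H) * (4 * H * (√(m:ℝ) - √n) ^ 2) := by gcongr
      _ = 48 * (H * √H) * 1 * (√(m:ℝ) - √n) ^ 2 := by ring
      _ ≤ 432 * (H * √H) * π ^ 2 * (√(m:ℝ) - √n) ^ 2 := by gcongr; norm_num
      _ = _ := by ring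

lemma gg_sum (s : Finset ℕ) (m : ℕ) : ∑ n ∈ s, gg m n ≤ 5 := by
  have aux : ∀ (t : Finset ℕ) (f : ℕ → ℕ), Set.InjOn f t → (∀ n ∈ t, 1 ≤ f n) →
      (∀ n ∈ t, gg m n = ((f n : ℝ) ^ 2)⁻¹) → ∑ n ∈ t, gg m n ≤ 2 := by
    intro t f hf h1 hg
    rw [Finset.sum_congr rfl hg, ← Finset.sum_image (f := fun k : ℕ => ((k : ℝ) ^ 2)⁻¹) hf]
    obtain ⟨N, hN⟩ := (t.image f).exists_nat_subset_range
    refine (Finset.sum_le_sum_of_subset_of_nonneg (t := Finset.Ioo 0 N) ?_ ?_).trans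
      ((sum_Ioo_inv_sq_le 0 N).trans ?_)
    · intro k hk
      have := hN hk
      obtain ⟨n, hn, rfl⟩ := Finset.mem_image.mp hk
      have := h1 n hn
      simp at *; omega
    · intros; positivity
    · norm_num
  have e : ∀ n, gg m n = (if n < m then gg m n else 0) + (if m < n then gg m n else 0)
      + (if n = m then 1 else 0) := by
    intro n
    rcases lt_trichotomy n m with h | h | h
    · simp [h, h.not_gt, h.ne]
    · simp [h, gg]
    · simp [h, h.not_gt, h.ne']
  rw [Finset.sum_congr rfl (fun n _ => e n), Finset.sum_add_distrib, Finset.sum_add_distrib,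
    ← Finset.sum_filter, ← Finset.sum_filter]
  have h1 : ∑ n ∈ s with n < m, gg m n ≤ 2 := by
    apply aux _ (fun n => m - n)
    · intro a ha b hb hab; simp at *; omega
    · intro n hn; simp at *; omega
    · intro n hn
      have hn : n < m := (Finset.mem_filter.mp hn).2
      simp [gg, hn.ne', Nat.cast_sub hn.le]
  have h2 : ∑ n ∈ s with m < n, gg m n ≤ 2 := by
    apply aux _ (fun n => n - m)
    · intro a ha b hb hab; simp at *; omega
    · intro n hn; simp at *; omega
    · intro n hn
      have hn : m < n := (Finset.mem_filter.mp hn).2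
      rw [gg_comm]
      simp [gg, hn.ne', Nat.cast_sub hn.le]
  have h3 : ∑ n ∈ s, (if n = m then (1:ℝ) else 0) ≤ 1 := by
    rw [Finset.sum_ite_eq']; split_ifs <;> norm_num
  linarith

noncomputable def SS (s : Finset ℕ) (a : ℕ → ℝ) (u : ℝ) : ℝ :=
  ∑ n ∈ s, a n * cos (4 * π * √n * u - π / 4)

lemma SS_sq (s : Finset ℕ) (a : ℕ → ℝ) (u : ℝ) : SS s a u ^ 2 ≤
    ∑ m ∈ s, ∑ n ∈ s, a m * a n * cos ((4 * π * √m - 4 * π * √n) * u) := by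
  have : ∑ m ∈ s, ∑ n ∈ s, a m * a n * cos ((4 * π * √m - 4 * π * √n) * u)
      = SS s a u ^ 2 + (∑ n ∈ s, a n * sin (4 * π * √n * u - π / 4)) ^ 2 := by
    unfold SS
    rw [sq, sq, Finset.sum_mul_sum, Finset.sum_mul_sum, ← Finset.sum_add_distrib]
    refine Finset.sum_congr rfl fun m _ => ?_
    rw [← Finset.sum_add_distrib]
    refine Finset.sum_congr rfl fun n _ => ?_
    rw [show (4 * π * √m - 4 * π * √n) * u = (4 * π * √m * u - π / 4) - (4 * π * √n * u - π / 4) by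
      ring, cos_sub (4 * π * √m * u - π / 4)]
    ring
  rw [this]
  nlinarith [sq_nonneg (∑ n ∈ s, a n * sin (4 * π * √n * u - π / 4))]

lemma large_sieve (s : Finset ℕ) (a : ℕ → ℝ) (ha : ∀ n, 0 ≤ a n) (H : ℝ) (hH : 1 ≤ H)
    (hs : ∀ n ∈ s, (n : ℝ) ≤ H) :
    ∫ u in (0:ℝ)..(3 * √H), u * (3 * √H - u) * SS s a u ^ 2
      ≤ 135 * (H * √H) * ∑ n ∈ s, a n ^ 2 := by
  have hB : 0 ≤ 3 * √H := by positivity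
  calc ∫ u in (0:ℝ)..(3 * √H), u * (3 * √H - u) * SS s a u ^ 2
      ≤ ∫ u in (0:ℝ)..(3 * √H), ∑ m ∈ s, ∑ n ∈ s, a m * a n *
          (u * (3 * √H - u) * cos ((4 * π * √m - 4 * π * √n) * u)) := by
        apply intervalIntegral.integral_mono_on hB
        · apply Continuous.intervalIntegrable; unfold SS; fun_prop
        · apply Continuous.intervalIntegrable; fun_prop
        · intro u hu
          have h1 : 0 ≤ u * (3 * √H - u) := mul_nonneg hu.1 (by linarith [hu.2])
          refine (mul_le_mul_of_nonneg_left (SS_sq s a u) h1).trans (le_of_eq ?_)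
          rw [Finset.mul_sum]
          refine Finset.sum_congr rfl fun m _ => ?_
          rw [Finset.mul_sum]
          refine Finset.sum_congr rfl fun n _ => ?_
          ring
    _ = ∑ m ∈ s, ∑ n ∈ s, a m * a n * ∫ u in (0:ℝ)..(3 * √H),
          (u * (3 * √H - u) * cos ((4 * π * √m - 4 * π * √n) * u)) := by
        rw [intervalIntegral.integral_finsetSum
          (fun m _ => Continuous.intervalIntegrable (by fun_prop) _ _)]
        refine Finset.sum_congr rfl fun m _ => ?_
        rw [intervalIntegral.integral_finsetSum
          (fun m _ => Continuous.intervalIntegrable (by fun_prop) _ _)]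
        refine Finset.sum_congr rfl fun n _ => ?_
        rw [intervalIntegral.integral_const_mul]
    _ ≤ ∑ m ∈ s, ∑ n ∈ s, (27 * (H * √H) / 2 * (a m ^ 2 * gg m n) +
          27 * (H * √H) / 2 * (a n ^ 2 * gg n m)) := by
        refine Finset.sum_le_sum fun m hm => Finset.sum_le_sum fun n hn => ?_
        refine (mul_le_mul_of_nonneg_left (ker_bound H hH m n (hs m hm) (hs n hn))
          (mul_nonneg (ha m) (ha n))).trans ?_
        rw [gg_comm n m]
        have h1 : 0 ≤ (H * √H) * gg m n := mul_nonneg (by positivity) (gg_nonneg m n)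
        nlinarith [mul_nonneg h1 (sq_nonneg (a m - a n))]
    _ = 27 * (H * √H) * ∑ m ∈ s, a m ^ 2 * ∑ n ∈ s, gg m n := by
        simp_rw [Finset.sum_add_distrib]
        rw [Finset.sum_comm (f := fun m n => 27 * (H * √H) / 2 * (a n ^ 2 * gg n m))]
        simp_rw [← Finset.mul_sum]
        ring
    _ ≤ 27 * (H * √H) * ∑ m ∈ s, a m ^ 2 * 5 := by
        gcongr with m hm
        exact gg_sum s m
    _ = _ := by rw [← Finset.sum_mul]; ring

lemma inv_three_halves (c : ℕ) (hc : 1 ≤ c) :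
    1 / ((c : ℝ) * √c) ≤ 4 * (1 / √(c:ℝ) - 1 / √((c + 1 : ℕ) : ℝ)) := by
  have hc' : (1:ℝ) ≤ c := by exact_mod_cast hc
  have hp : √(c:ℝ) ^ 2 = c := Real.sq_sqrt (by positivity)
  have hq : √((c + 1 : ℕ) : ℝ) ^ 2 = c + 1 := by rw [Real.sq_sqrt (by positivity)]; push_cast; ring
  have hp1 : 1 ≤ √(c:ℝ) := Real.one_le_sqrt.mpr hc'
  have hq0 : 0 < √((c + 1 : ℕ) : ℝ) := by positivity
  set p := √(c:ℝ)
  set q := √((c + 1 : ℕ) : ℝ)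
  rw [← hp] at hq ⊢
  have hpq : p ≤ q := by nlinarith
  have hq2 : q ≤ 2 * p := by nlinarith
  have key : q ≤ 4 * p ^ 2 * (q - p) := by
    have h1 : (q - p) * (q + p) = 1 := by nlinarith
    have h2 : q * (q + p) ≤ 4 * p ^ 2 := by nlinarith
    have h3 : 0 ≤ q - p := by linarith
    calc q = (q * (q + p)) * (q - p) := by linear_combination (-q) * h1
      _ ≤ _ := by gcongr
  have hp0 : 0 < p := by linarith
  rw [div_sub_div _ _ hp0.ne' hq0.ne', ← mul_div_assoc, div_le_div_iff₀ (by positivity) (by positivity)]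
  nlinarith

lemma tail_aux_s16 (m N : ℕ) (h : m ≤ N) : ∑ c ∈ Finset.Ioc m N, 1 / ((c : ℝ) * √c) ≤
    4 * (1 / √((m + 1 : ℕ) : ℝ) - 1 / √((N + 1 : ℕ) : ℝ)) := by
  induction N, h using Nat.le_induction with
  | base => simp
  | succ N h ih =>
    rw [Finset.sum_Ioc_succ_top h]
    have := inv_three_halves (N + 1) (by omega)
    linarith

lemma tail (t : ℝ) (ht : 0 < t) (N : ℕ) :
    ∑ c ∈ Finset.Icc 1 N with ((c:ℕ):ℝ) > t, 1 / ((c : ℝ) * √c) ≤ 4 / √t := by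
  have hsub : (Finset.Icc 1 N).filter (fun c : ℕ => (c:ℝ) > t) ⊆ Finset.Ioc ⌊t⌋₊ N := by
    intro c hc
    simp only [Finset.mem_filter, Finset.mem_Icc, Finset.mem_Ioc] at *
    exact ⟨(Nat.floor_lt ht.le).mpr hc.2, hc.1.2⟩
  refine (Finset.sum_le_sum_of_subset_of_nonneg hsub (by intros; positivity)).trans ?_
  rcases le_total ⌊t⌋₊ N with h | h
  · refine (tail_aux_s16 _ _ h).trans ?_
    have h1 : 0 ≤ 1 / √((N + 1 : ℕ) : ℝ) := by positivity
    have h2 : 1 / √((⌊t⌋₊ + 1 : ℕ) : ℝ) ≤ 1 / √t := by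
      gcongr
      push_cast
      exact (Nat.lt_floor_add_one t).le
    calc _ ≤ 4 * (1 / √t) := by linarith
      _ = _ := by ring
  · rw [Finset.Ioc_eq_empty (by omega)]; simp; positivity

def quads (N : ℕ) : Finset ((ℕ × ℕ × ℕ) × ℕ) :=
  (Finset.Icc 1 N ×ˢ Finset.Icc 1 N ×ˢ Finset.Icc 1 N) ×ˢ Finset.Icc 1 N

lemma card_sq_le (N n : ℕ) (hn : 1 ≤ n) (hN : n ≤ N) :
    n.divisors.card ^ 2 ≤
      ((quads N).filter (fun q => q.1.1 * q.1.2.1 * q.1.2.2 * q.2 = n)).card := by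
  rw [sq, ← Finset.card_product]
  apply Finset.card_le_card_of_injOn
    (fun p => ((Nat.gcd p.1 p.2, p.1 / Nat.gcd p.1 p.2, p.2 / Nat.gcd p.1 p.2), n / Nat.lcm p.1 p.2))
  · rintro ⟨a, b⟩ hab
    simp only [Finset.coe_product, Set.mem_prod, Finset.mem_coe, Nat.mem_divisors] at hab
    obtain ⟨⟨ha, hn0⟩, hb, -⟩ := hab
    have ha0 : 0 < a := Nat.pos_of_dvd_of_pos ha hn
    have hb0 : 0 < b := Nat.pos_of_dvd_of_pos hb hn
    have hg0 : 0 < Nat.gcd a b := Nat.gcd_pos_of_pos_left _ ha0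
    have hl : Nat.lcm a b ∣ n := Nat.lcm_dvd ha hb
    have hl0 : 0 < Nat.lcm a b := Nat.lcm_pos ha0 hb0
    have haN := (Nat.le_of_dvd hn ha).trans hN
    have hbN := (Nat.le_of_dvd hn hb).trans hN
    have hga := Nat.gcd_dvd_left a b
    have hgb := Nat.gcd_dvd_right a b
    have hprod : Nat.gcd a b * (a / Nat.gcd a b) * (b / Nat.gcd a b) = Nat.lcm a b := by
      rw [Nat.mul_div_cancel' hga, Nat.lcm, Nat.mul_div_assoc _ hgb]
    simp only [quads, Finset.coe_filter, Finset.mem_product, Finset.mem_Icc, Set.mem_ofPred_eq]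
    refine ⟨⟨⟨⟨hg0, (Nat.le_of_dvd ha0 hga).trans haN⟩,
      ⟨Nat.div_pos (Nat.le_of_dvd ha0 hga) hg0, (Nat.div_le_self _ _).trans haN⟩,
      ⟨Nat.div_pos (Nat.le_of_dvd hb0 hgb) hg0, (Nat.div_le_self _ _).trans hbN⟩⟩,
      ⟨Nat.div_pos (Nat.le_of_dvd hn hl) hl0, (Nat.div_le_self _ _).trans hN⟩⟩, ?_⟩
    rw [hprod, Nat.mul_div_cancel' hl]
  · rintro ⟨a, b⟩ - ⟨a', b'⟩ - h
    simp only [Prod.mk.injEq] at h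
    obtain ⟨⟨h1, h2, h3⟩, -⟩ := h
    have e1 := Nat.mul_div_cancel' (Nat.gcd_dvd_left a b)
    have e2 := Nat.mul_div_cancel' (Nat.gcd_dvd_right a b)
    have e3 := Nat.mul_div_cancel' (Nat.gcd_dvd_left a' b')
    have e4 := Nat.mul_div_cancel' (Nat.gcd_dvd_right a' b')
    rw [h2, h1, e3] at e1
    rw [h3, h1, e4] at e2
    rw [e1, e2]

lemma div_sum (Y : ℝ) (hY : 2 ≤ Y) (N : ℕ) :
    ∑ n ∈ Finset.Ioc ⌊Y⌋₊ N, dd n ^ 2 * (1 / ((n:ℝ) * √n)) ≤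
      4 / √Y * (∑ k ∈ Finset.Icc 1 N, 1 / (k : ℝ)) ^ 3 := by
  set f : ℕ → ℝ := fun n => 1 / ((n:ℝ) * √n) with hf
  have hf0 : ∀ n, 0 ≤ f n := fun n => by simp only [hf]; positivity
  let P : (ℕ × ℕ × ℕ) × ℕ → ℕ := fun q => q.1.1 * q.1.2.1 * q.1.2.2 * q.2
  calc ∑ n ∈ Finset.Ioc ⌊Y⌋₊ N, dd n ^ 2 * f n
      ≤ ∑ n ∈ Finset.Ioc ⌊Y⌋₊ N, ∑ q ∈ quads N with P q = n, f (P q) := by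
        refine Finset.sum_le_sum fun n hn => ?_
        rw [Finset.mem_Ioc] at hn
        have h1 := card_sq_le N n (by omega) hn.2
        have h2 : ∑ q ∈ quads N with P q = n, f (P q) =
            ((quads N).filter (fun q => P q = n)).card * f n := by
          rw [Finset.sum_congr rfl (g := fun _ => f n)
            (fun q hq => by rw [(Finset.mem_filter.mp hq).2])]
          simp
        rw [h2]
        have : dd n ^ 2 ≤ (((quads N).filter (fun q => P q = n)).card : ℝ) := by
          unfold dd; exact_mod_cast h1
        exact mul_le_mul_of_nonneg_right this (hf0 n)
    _ = ∑ q ∈ quads N with P q ∈ Finset.Ioc ⌊Y⌋₊ N, f (P q) := by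
        simp_rw [Finset.sum_filter]
        rw [Finset.sum_comm]
        refine Finset.sum_congr rfl fun q _ => ?_
        rw [Finset.sum_ite_eq]
    _ ≤ ∑ q ∈ quads N with (P q : ℝ) > Y, f (P q) := by
        refine Finset.sum_le_sum_of_subset_of_nonneg ?_ (fun q _ _ => hf0 _)
        intro q hq
        simp only [Finset.mem_filter, Finset.mem_Ioc] at *
        exact ⟨hq.1, (Nat.floor_lt (by linarith)).mp hq.2.1⟩
    _ = ∑ r ∈ Finset.Icc 1 N ×ˢ Finset.Icc 1 N ×ˢ Finset.Icc 1 N, ∑ c ∈ Finset.Icc 1 N,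
          if (P (r, c) : ℝ) > Y then f (P (r, c)) else 0 := by
        rw [Finset.sum_filter, quads, Finset.sum_product]
    _ ≤ ∑ r ∈ Finset.Icc 1 N ×ˢ Finset.Icc 1 N ×ˢ Finset.Icc 1 N,
          4 / √Y * (1 / (r.1 : ℝ) * (1 / (r.2.1 : ℝ) * (1 / (r.2.2 : ℝ)))) := by
        refine Finset.sum_le_sum fun r hr => ?_
        simp only [Finset.mem_product, Finset.mem_Icc] at hr
        have hk : 1 ≤ r.1 * r.2.1 * r.2.2 :=
          Nat.mul_pos (Nat.mul_pos hr.1.1 hr.2.1.1) hr.2.2.1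
        have hrk : 1 / (r.1 : ℝ) * (1 / (r.2.1 : ℝ) * (1 / (r.2.2 : ℝ))) =
            1 / ((r.1 * r.2.1 * r.2.2 : ℕ) : ℝ) := by
          push_cast; field_simp
        rw [hrk]
        have hP : ∀ c, P (r, c) = (r.1 * r.2.1 * r.2.2) * c := fun c => rfl
        simp_rw [hP]
        generalize r.1 * r.2.1 * r.2.2 = k at hk
        have hk0 : (0:ℝ) < k := by exact_mod_cast hk
        rw [← Finset.sum_filter]
        have e1 : ∀ c : ℕ, (((k * c : ℕ) : ℝ) > Y) ↔ ((c : ℝ) > Y / k) := by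
          intro c
          push_cast
          rw [gt_iff_lt, gt_iff_lt, div_lt_iff₀' hk0]
        have e2 : ∀ c : ℕ, f (k * c) = f k * (1 / ((c:ℝ) * √c)) := by
          intro c
          simp only [hf]
          push_cast
          rw [Real.sqrt_mul hk0.le]
          ring
        simp_rw [e1, e2]
        rw [← Finset.mul_sum]
        refine (mul_le_mul_of_nonneg_left (tail (Y / k) (by positivity) N) (hf0 k)).trans
          (le_of_eq ?_)
        simp only [hf]
        rw [Real.sqrt_div (by linarith)]
        have : 0 < √Y := Real.sqrt_pos.mpr (by linarith)
        have : 0 < √(k:ℝ) := Real.sqrt_pos.mpr hk0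
        field_simp
    _ = _ := by
        rw [← Finset.mul_sum, Finset.sum_product]
        simp_rw [← Finset.mul_sum]
        rw [← Finset.sum_mul, Finset.sum_product]
        simp_rw [← Finset.mul_sum]
        rw [← Finset.sum_mul]
        ring

theorem second_moment_tail :
    ∃ C : ℝ, 0 < C ∧
      ∀ H Y : ℝ, 10 ≤ H → 2 ≤ Y → Y ≤ H →
        (∫ x in H..(2 * H), RYX Y H x ^ 2) ≤
          C * H ^ ((3 : ℝ) / 2) * Real.log H ^ 3 * Y ^ (-(1 : ℝ) / 2) := by
  refine ⟨8640, by norm_num, fun H Y hH hY hYH => ?_⟩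
  have hH0 : 0 < H := by linarith
  have hY0 : 0 < Y := by linarith
  set s := Finset.Ioc ⌊Y⌋₊ ⌊H⌋₊ with hs
  set a : ℕ → ℝ := fun n => dd n * (n : ℝ) ^ (-(3 : ℝ) / 4) with ha
  have ha0 : ∀ n, 0 ≤ a n := fun n => by simp only [ha, dd]; positivity
  have hsH : ∀ n ∈ s, (n : ℝ) ≤ H := by
    intro n hn
    exact (Nat.le_floor_iff hH0.le).mp (Finset.mem_Ioc.mp hn).2
  have hSc : Continuous (SS s a) := by unfold SS; fun_prop
  have hR : ∀ x, 0 < x → RYX Y H x ^ 2 = √x * SS s a (√x) ^ 2 := by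
    intro x hx
    have h1 : (x ^ ((1:ℝ)/4)) ^ 2 = √x := by
      rw [← Real.rpow_natCast, ← Real.rpow_mul hx.le, Real.sqrt_eq_rpow]; norm_num
    unfold RYX
    rw [mul_pow, h1]
    congr 2
    unfold SS
    refine Finset.sum_congr rfl fun n _ => ?_
    rw [Real.sqrt_mul (by positivity)]
    simp only [ha, mul_assoc]
  have hsub : ∫ x in H..(2 * H), RYX Y H x ^ 2 =
      ∫ u in (√H)..(√(2 * H)), 2 * u ^ 2 * SS s a u ^ 2 := by
    have hle : H ≤ 2 * H := by linarith
    rw [← intervalIntegral.integral_comp_mul_deriv (f := fun x => √x)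
      (f' := fun x => 1 / (2 * √x)) (g := fun u => 2 * u ^ 2 * SS s a u ^ 2)]
    · apply intervalIntegral.integral_congr
      intro x hx
      rw [Set.uIcc_of_le hle] at hx
      have hx0 : 0 < x := by linarith [hx.1]
      have : 0 < √x := Real.sqrt_pos.mpr hx0
      simp only [hR x hx0, Function.comp]
      field_simp
    · intro x hx
      rw [Set.uIcc_of_le hle] at hx
      exact Real.hasDerivAt_sqrt (by linarith [hx.1])
    · intro x hx
      rw [Set.uIcc_of_le hle] at hx
      have hx0 : 0 < x := by linarith [hx.1]
      have : 2 * √x ≠ 0 := by positivity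
      have h1 : ContinuousAt (fun x : ℝ => 2 * √x) x := by fun_prop
      exact ((continuousAt_const (y := (1:ℝ))).div h1 this).continuousWithinAt
    · fun_prop
  have hsH0 : 0 < √H := Real.sqrt_pos.mpr hH0
  have h2H : √(2 * H) ≤ 3 / 2 * √H := by
    rw [Real.sqrt_mul (by norm_num)]
    gcongr
    rw [Real.sqrt_le_left (by norm_num)]; norm_num
  have hle : √H ≤ √(2 * H) := Real.sqrt_le_sqrt (by linarith)
  have hint : ∫ u in (√H)..(√(2 * H)), 2 * u ^ 2 * SS s a u ^ 2 ≤
      2 * (135 * (H * √H) * ∑ n ∈ s, a n ^ 2) := by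
    calc _ ≤ ∫ u in (√H)..(√(2 * H)), 2 * (u * (3 * √H - u) * SS s a u ^ 2) := by
          apply intervalIntegral.integral_mono_on hle
          · apply Continuous.intervalIntegrable; fun_prop
          · apply Continuous.intervalIntegrable; fun_prop
          · intro u hu
            have h1 : u ^ 2 ≤ u * (3 * √H - u) := by nlinarith [hu.1, hu.2]
            nlinarith [mul_le_mul_of_nonneg_right h1 (sq_nonneg (SS s a u))]
      _ = 2 * ∫ u in (√H)..(√(2 * H)), (u * (3 * √H - u) * SS s a u ^ 2) := by
          rw [intervalIntegral.integral_const_mul]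
      _ ≤ 2 * ∫ u in (0:ℝ)..(3 * √H), (u * (3 * √H - u) * SS s a u ^ 2) := by
          gcongr
          apply intervalIntegral.integral_mono_interval hsH0.le hle (by linarith)
          · filter_upwards [ae_restrict_mem measurableSet_Ioc] with u hu
            exact mul_nonneg (mul_nonneg hu.1.le (by linarith [hu.2])) (sq_nonneg _)
          · apply Continuous.intervalIntegrable; fun_prop
      _ ≤ _ := by
          gcongr
          exact large_sieve s a ha0 H (by linarith) hsH
  have hasq : ∑ n ∈ s, a n ^ 2 ≤ 4 / √Y * (2 * Real.log H) ^ 3 := by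
    have e : ∀ n ∈ s, a n ^ 2 = dd n ^ 2 * (1 / ((n:ℝ) * √n)) := by
      intro n hn
      have hn0 : 0 < n := by have := (Finset.mem_Ioc.mp hn).1; omega
      have hn0' : (0:ℝ) < n := by exact_mod_cast hn0
      simp only [ha]
      rw [mul_pow]
      congr 1
      rw [← Real.rpow_natCast, ← Real.rpow_mul hn0'.le, Real.sqrt_eq_rpow]
      nth_rewrite 2 [← Real.rpow_one (n:ℝ)]
      rw [← Real.rpow_add hn0', one_div, ← Real.rpow_neg hn0'.le]
      norm_num
    rw [Finset.sum_congr rfl e]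
    refine (div_sum Y hY _).trans ?_
    have hlog : 1 ≤ Real.log H := by
      rw [Real.le_log_iff_exp_le hH0]
      linarith [Real.exp_one_lt_d9]
    have hh := harmonic_floor_le_one_add_log H (by linarith)
    rw [harmonic_eq_sum_Icc] at hh
    push_cast at hh
    gcongr
    simp only [one_div]
    linarith
  have eH : H ^ ((3:ℝ)/2) = H * √H := by
    rw [Real.sqrt_eq_rpow]
    nth_rewrite 2 [← Real.rpow_one H]
    rw [← Real.rpow_add hH0]; norm_num
  have eY : Y ^ (-(1:ℝ)/2) = 1 / √Y := by
    rw [Real.sqrt_eq_rpow, one_div, ← Real.rpow_neg hY0.le]; norm_num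
  rw [hsub, eH, eY]
  calc _ ≤ _ := hint
    _ ≤ 2 * (135 * (H * √H) * (4 / √Y * (2 * Real.log H) ^ 3)) := by gcongr
    _ = _ := by ring
end
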